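/- arXiv:0810.4656 — 3 statements merged into one kernel-verified Lean document; each statement's English description precedes it below -/
import Mathlib

section
/- Let A be the monomial algebra on 13 generators defined below, and let K be the trivial A-module. Then A is a K₂ algebra: the Yoneda algebra E(A) = ⊕ₙ Extᴬⁿ(K,K) is generated as a K-algebra by E¹(A) and E²(A). Equivalently, for every n ≥ 3, Extᴬⁿ(K,K) is spanned over K by Yoneda products of a class in Extᴬⁿ⁻¹(K,K) with a class in Extᴬ¹(K,K) together with Yoneda products of a class in Extᴬⁿ⁻²(K,K) with a class in Extᴬ²(K,K). -/
/-!
Let `K` be a field and `V` a 13-dimensional `K`-vector space with basis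
`{m,n,p,q,r,s,t,u,v,w,x,y,z}`.  Let `A = T(V)/I` be the quotient of the free
(tensor) algebra on `V` by the two-sided ideal generated by the nine monomials
`mn²p, n²pqr, npqrs, pqrst, stu, tuvwx, uvwxy, vwxy², xy²z`, and regard `K` as
the trivial left `A`-module via the augmentation sending every generator to `0`.
-/

open CategoryTheory

/-- The thirteen generators `m,n,p,q,r,s,t,u,v,w,x,y,z` of the algebra `A`. -/
inductive Gen : Type
  | m | n | p | q | r | s | t | u | v | w | x | y | z

variable (K : Type) [Field K]

open Gen

/-- The generator `i`, as an element of the tensor algebra `T(V)`. -/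
noncomputable def g (i : Gen) : FreeAlgebra K Gen := FreeAlgebra.ι K i

/-- The relation identifying each of the nine defining monomials with `0`;
the quotient of `T(V)` by this relation is exactly `T(V)/I` where `I` is the
two-sided ideal generated by the nine monomials. -/
inductive MonRel : FreeAlgebra K Gen → FreeAlgebra K Gen → Prop
  | mnnp : MonRel (g K m * g K n * g K n * g K p) 0
  | nnpqr : MonRel (g K n * g K n * g K p * g K q * g K r) 0
  | npqrs : MonRel (g K n * g K p * g K q * g K r * g K s) 0
  | pqrst : MonRel (g K p * g K q * g K r * g K s * g K t) 0
  | stu : MonRel (g K s * g K t * g K u) 0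
  | tuvwx : MonRel (g K t * g K u * g K v * g K w * g K x) 0
  | uvwxy : MonRel (g K u * g K v * g K w * g K x * g K y) 0
  | vwxyy : MonRel (g K v * g K w * g K x * g K y * g K y) 0
  | xyyz : MonRel (g K x * g K y * g K y * g K z) 0

/-- The monomial algebra `A = T(V)/I`. -/
noncomputable abbrev A : Type := RingQuot (MonRel K)

/-- The augmentation `A →ₐ[K] K`, sending every generator to `0`. -/
noncomputable def aug : A K →ₐ[K] K :=
  RingQuot.liftAlgHom K ⟨FreeAlgebra.lift K (fun _ => (0 : K)), by
    rintro x y h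
    induction h <;> simp [g]⟩

/-- `K`, regarded as the trivial left `A`-module via the augmentation. -/
noncomputable def KMod : ModuleCat.{0} (A K) :=
  letI : Module (A K) K := Module.compHom K (aug K).toRingHom
  ModuleCat.of (A K) K

noncomputable local instance instDC : HasDerivedCategory.{1} (ModuleCat.{0} (A K)) :=
  HasDerivedCategory.standard _

local instance instHE : HasExt.{1} (ModuleCat.{0} (A K)) :=
  @hasExt_of_hasDerivedCategory.{1, 0, 1} (ModuleCat.{0} (A K)) _ _ (instDC K)

/-- The Ext group `Extᴬⁿ(K, K)`; the Yoneda product of `a : E K i` and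
`b : E K j` is given by the composition `a.comp b : E K (i + j)`. -/
noncomputable abbrev E (n : ℕ) : Type 1 := Abelian.Ext (KMod K) (KMod K) n

open Abelian in
lemma mk₀_add {X Y : ModuleCat.{0} (A K)} (f f' : X ⟶ Y) :
    Ext.mk₀ (f + f') = Ext.mk₀ f + Ext.mk₀ f' := by
  apply Abelian.Ext.ext
  rw [Ext.add_hom, Ext.mk₀_hom, Ext.mk₀_hom, Ext.mk₀_hom]
  simp [ShiftedHom.mk₀, Functor.map_add, Preadditive.add_comp]

open Abelian in
/-- The scalar action of `K` on the Ext groups, given by composition with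
`c • 𝟙`; this is the `K`-vector space structure of the Yoneda algebra `E(A)`. -/
noncomputable def extSMul {X Y : ModuleCat.{0} (A K)} {n : ℕ} (c : K)
    (α : Ext X Y n) : Ext X Y n :=
  α.comp (Ext.mk₀ (c • 𝟙 Y)) (add_zero n)

open Abelian in
noncomputable instance {X Y : ModuleCat.{0} (A K)} {n : ℕ} :
    Module K (Ext X Y n) where
  smul := extSMul K
  one_smul α := by
    show extSMul K 1 α = α
    rw [extSMul, one_smul, Ext.comp_mk₀_id]
  mul_smul a b α := by
    show extSMul K (a * b) α = extSMul K a (extSMul K b α)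
    rw [extSMul, extSMul, extSMul,
      Ext.comp_assoc_of_third_deg_zero, Ext.mk₀_comp_mk₀]
    congr 1
    rw [Linear.smul_comp, Linear.comp_smul, Category.id_comp, smul_smul, mul_comm]
  smul_zero c := by
    show extSMul K c (0 : Ext X Y n) = 0
    rw [extSMul, Ext.zero_comp]
  smul_add c α β := by
    show extSMul K c (α + β) = extSMul K c α + extSMul K c β
    rw [extSMul, extSMul, extSMul, Ext.add_comp]
  add_smul a b α := by
    show extSMul K (a + b) α = extSMul K a α + extSMul K b α
    rw [extSMul, extSMul, extSMul, add_smul, mk₀_add, Ext.comp_add]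
  zero_smul α := by
    show extSMul K 0 α = 0
    rw [extSMul, zero_smul, Ext.mk₀_zero, Ext.comp_zero]



namespace MonomialAlgebra

instance : DecidableEq Gen := fun a b =>
  decidable_of_iff (a.ctorIdx = b.ctorIdx)
    ⟨by cases a <;> cases b <;> simp [Gen.ctorIdx], congrArg _⟩

instance : Fintype Gen :=
  ⟨{m, n, p, q, r, s, t, u, v, w, x, y, z}, by intro i; cases i <;> decide⟩

/-- The nine defining monomials of `A`, as words. -/
def relWords : List (List Gen) :=
  [[m, n, n, p], [n, n, p, q, r], [n, p, q, r, s], [p, q, r, s, t], [s, t, u],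
    [t, u, v, w, x], [u, v, w, x, y], [v, w, x, y, y], [x, y, y, z]]

/-- A word is normal if none of the defining monomials is a factor of it. -/
def Normal (a : List Gen) : Prop := ∀ R ∈ relWords, ¬ R <:+: a

instance : DecidablePred Normal := fun a =>
  inferInstanceAs (Decidable (∀ R ∈ relWords, ¬ R <:+: a))

lemma Normal.mono {a b : List Gen} (h : Normal b) (hab : a <:+: b) : Normal a :=
  fun R hR hRa => h R hR (hRa.trans hab)

/-- The class of a generator in `A`. -/
noncomputable def gen (i : Gen) : A K := RingQuot.mkAlgHom K (MonRel K) (g K i)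

/-- The class of a word in `A`. -/
noncomputable def word (a : List Gen) : A K := (a.map (gen K)).prod

@[simp] lemma word_nil : word K [] = 1 := rfl

@[simp] lemma word_cons (i : Gen) (a : List Gen) : word K (i :: a) = gen K i * word K a := by
  simp [word]

lemma word_append (a b : List Gen) : word K (a ++ b) = word K a * word K b := by
  simp [word]

lemma word_relWords {R : List Gen} (hR : R ∈ relWords) : word K R = 0 := by
  have key {a : FreeAlgebra K Gen} (h : MonRel K a 0) : RingQuot.mkAlgHom K (MonRel K) a = 0 := by
    rw [RingQuot.mkAlgHom_rel K h, map_zero]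
  simp only [relWords, List.mem_cons, List.not_mem_nil, or_false] at hR
  rcases hR with rfl | rfl | rfl | rfl | rfl | rfl | rfl | rfl | rfl
  · simpa [gen, mul_assoc] using key .mnnp
  · simpa [gen, mul_assoc] using key .nnpqr
  · simpa [gen, mul_assoc] using key .npqrs
  · simpa [gen, mul_assoc] using key .pqrst
  · simpa [gen, mul_assoc] using key .stu
  · simpa [gen, mul_assoc] using key .tuvwx
  · simpa [gen, mul_assoc] using key .uvwxy
  · simpa [gen, mul_assoc] using key .vwxyy
  · simpa [gen, mul_assoc] using key .xyyz

lemma word_eq_zero {a : List Gen} (ha : ¬ Normal a) : word K a = 0 := by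
  simp only [Normal, not_forall, not_not] at ha
  obtain ⟨R, hR, b, c, rfl⟩ := ha
  simp [word_append, word_relWords K hR]

variable {K} in
lemma induction_on {C : A K → Prop} (a : A K) (scalar : ∀ c, C (algebraMap K (A K) c))
    (gen : ∀ i, C (gen K i)) (mul : ∀ a b, C a → C b → C (a * b))
    (add : ∀ a b, C a → C b → C (a + b)) : C a := by
  obtain ⟨a, rfl⟩ := RingQuot.mkAlgHom_surjective K (MonRel K) a
  induction a using FreeAlgebra.induction with
  | grade0 c => rw [AlgHom.commutes]; exact scalar c
  | grade1 i => exact gen i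
  | mul a b ha hb => rw [map_mul]; exact mul _ _ ha hb
  | add a b ha hb => rw [map_add]; exact add _ _ ha hb

/-- Left multiplication by a generator on the span of normal words. -/
noncomputable def consMap (i : Gen) : Module.End K (List Gen →₀ K) :=
  Finsupp.linearCombination K fun a =>
    if Normal (i :: a) then Finsupp.single (i :: a) (1 : K) else 0

lemma consMap_single (i : Gen) (a : List Gen) :
    consMap K i (Finsupp.single a 1) =
      if Normal (i :: a) then Finsupp.single (i :: a) (1 : K) else 0 := by
  simp [consMap]

lemma prod_consMap_single (i : Gen) (a b : List Gen) :
    ((i :: a).map (consMap K)).prod (Finsupp.single b 1) =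
      if Normal (i :: a ++ b) then Finsupp.single (i :: a ++ b) (1 : K) else 0 := by
  induction a generalizing i with
  | nil => simp [consMap_single]
  | cons j a ih =>
    rw [List.map_cons, List.prod_cons, Module.End.mul_apply, ih]
    split_ifs with h1 h2 h2
    · rw [consMap_single, if_pos (by simpa using h2)]; simp
    · rw [consMap_single, if_neg (by simpa using h2)]
    · exact absurd (h2.mono (List.infix_cons (List.infix_refl _))) h1
    · simp

lemma prod_consMap_relWords {R : List Gen} (hR : R ∈ relWords) :
    (R.map (consMap K)).prod = 0 := by
  ext1 b
  ext1
  obtain _ | ⟨i, a⟩ := R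
  · exact absurd hR (by decide)
  · simp only [LinearMap.coe_comp, Function.comp_apply, Finsupp.lsingle_apply,
      prod_consMap_single, LinearMap.zero_comp, LinearMap.zero_apply]
    exact if_neg fun h => h _ hR (List.prefix_append _ _).isInfix

/-- The action of `A` on the space spanned by words. -/
noncomputable def rep : A K →ₐ[K] Module.End K (List Gen →₀ K) :=
  RingQuot.liftAlgHom K ⟨FreeAlgebra.lift K (consMap K), by
    rintro _ _ h
    have key {R : List Gen} (hR : R ∈ relWords := by decide) := prod_consMap_relWords K hR
    cases h
    · simpa [g, mul_assoc] using key (R := [m, n, n, p])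
    · simpa [g, mul_assoc] using key (R := [n, n, p, q, r])
    · simpa [g, mul_assoc] using key (R := [n, p, q, r, s])
    · simpa [g, mul_assoc] using key (R := [p, q, r, s, t])
    · simpa [g, mul_assoc] using key (R := [s, t, u])
    · simpa [g, mul_assoc] using key (R := [t, u, v, w, x])
    · simpa [g, mul_assoc] using key (R := [u, v, w, x, y])
    · simpa [g, mul_assoc] using key (R := [v, w, x, y, y])
    · simpa [g, mul_assoc] using key (R := [x, y, y, z])⟩

@[simp] lemma rep_gen (i : Gen) : rep K (gen K i) = consMap K i := by
  simp [rep, gen, g]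

@[simp] lemma aug_gen (i : Gen) : aug K (gen K i) = 0 := by
  simp [aug, gen, g]

/-- The coordinates of an element of `A` with respect to the normal words. -/
noncomputable def coords : A K →ₗ[K] (List Gen →₀ K) :=
  LinearMap.applyₗ (Finsupp.single [] 1) ∘ₗ (rep K).toLinearMap

lemma coords_mul (a b : A K) : coords K (a * b) = rep K a (coords K b) := by
  simp [coords]

lemma coords_gen_mul (i : Gen) (b : A K) : coords K (gen K i * b) = consMap K i (coords K b) := by
  simp [coords_mul]

lemma coords_word (a : List Gen) :
    coords K (word K a) = if Normal a then Finsupp.single a 1 else 0 := by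
  obtain _ | ⟨i, a⟩ := a
  · rw [if_pos (by decide)]; simp [coords]
  · have := prod_consMap_single K i a []
    simp only [List.append_nil] at this
    rw [← this, word]
    simp [coords, map_list_prod, Function.comp_def]

/-- The element of `A` with given coordinates. -/
noncomputable def ofCoords : (List Gen →₀ K) →ₗ[K] A K := Finsupp.linearCombination K (word K)

@[simp] lemma ofCoords_single (a : List Gen) (c : K) :
    ofCoords K (Finsupp.single a c) = c • word K a := by
  simp [ofCoords]

lemma ofCoords_consMap (i : Gen) (f : List Gen →₀ K) :
    ofCoords K (consMap K i f) = gen K i * ofCoords K f := by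
  suffices ofCoords K ∘ₗ consMap K i = LinearMap.mulLeft K (gen K i) ∘ₗ ofCoords K from
    LinearMap.congr_fun this f
  ext a
  simp only [LinearMap.coe_comp, Function.comp_apply, Finsupp.lsingle_apply, consMap_single,
    ofCoords_single, one_smul, LinearMap.mulLeft_apply, ← word_cons]
  split_ifs with h
  · simp
  · rw [map_zero, word_eq_zero K h]

lemma ofCoords_rep (a : A K) (f : List Gen →₀ K) : ofCoords K (rep K a f) = a * ofCoords K f := by
  induction a using induction_on generalizing f with
  | scalar c => simp [Algebra.smul_def]
  | gen i => rw [rep_gen, ofCoords_consMap]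
  | mul a b ha hb => simp [ha, hb, mul_assoc]
  | add a b ha hb => simp [ha, hb, add_mul]

@[simp] lemma ofCoords_coords (a : A K) : ofCoords K (coords K a) = a := by
  simp [coords, ofCoords_rep]

variable {K} in
lemma linearMap_ext {M : Type*} [AddCommMonoid M] [Module K M] {f f' : A K →ₗ[K] M}
    (h : ∀ a, Normal a → f (word K a) = f' (word K a)) : f = f' := by
  suffices f ∘ₗ ofCoords K = f' ∘ₗ ofCoords K by
    ext a
    simpa using LinearMap.congr_fun this (coords K a)
  ext a
  by_cases ha : Normal a
  · simp [h a ha]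
  · simp [word_eq_zero K ha]

lemma coords_of_not_normal {b : List Gen} (hb : ¬ Normal b) (a : A K) : coords K a b = 0 := by
  suffices Finsupp.lapply b ∘ₗ coords K = 0 from LinearMap.congr_fun this a
  refine linearMap_ext fun a ha => ?_
  have : a ≠ b := by rintro rfl; exact hb ha
  simp [coords_word, ha, this]

lemma coords_mul_word {a b : List Gen} (h : Normal (b ++ a)) (c : A K) :
    coords K (c * word K a) (b ++ a) = coords K c b := by
  suffices Finsupp.lapply (b ++ a) ∘ₗ coords K ∘ₗ LinearMap.mulRight K (word K a) =
    Finsupp.lapply b ∘ₗ coords K from LinearMap.congr_fun this c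
  refine linearMap_ext fun d hd => ?_
  simp only [LinearMap.coe_comp, Function.comp_apply, LinearMap.mulRight_apply, ← word_append,
    coords_word, if_pos hd, Finsupp.lapply_apply]
  by_cases hdb : d = b
  · subst hdb; simp [h]
  · split_ifs <;> simp [hdb]

lemma coords_nil (a : A K) : coords K a [] = aug K a := by
  suffices Finsupp.lapply [] ∘ₗ coords K = (aug K).toLinearMap from LinearMap.congr_fun this a
  refine linearMap_ext fun a ha => ?_
  simp only [LinearMap.coe_comp, Function.comp_apply, coords_word, if_pos ha,
    Finsupp.lapply_apply, AlgHom.toLinearMap_apply]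
  cases a <;> simp

lemma consMap_apply_cons (i j : Gen) (b : List Gen) (f : List Gen →₀ K) :
    consMap K i f (j :: b) = if i = j ∧ Normal (j :: b) then f b else 0 := by
  suffices Finsupp.lapply (j :: b) ∘ₗ consMap K i =
      if i = j ∧ Normal (j :: b) then Finsupp.lapply b else 0 by
    have := LinearMap.congr_fun this f
    simp only [LinearMap.coe_comp, Function.comp_apply, Finsupp.lapply_apply] at this
    rw [this]
    split_ifs <;> simp
  ext a
  by_cases hab : a = b <;> by_cases hij : i = j
  · subst hab hij
    by_cases h : Normal (i :: a) <;> simp [consMap_single, h]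
  all_goals
    simp only [LinearMap.coe_comp, Function.comp_apply, Finsupp.lsingle_apply, consMap_single]
    split_ifs <;> simp_all

lemma coords_gen_mul_apply (i : Gen) (c : A K) {j : Gen} {b : List Gen} (h : coords K c b = 0) :
    coords K (gen K i * c) (j :: b) = 0 := by
  rw [coords_gen_mul, consMap_apply_cons, h, ite_self]

lemma mem_of_coords (J : Ideal (A K)) (c : A K)
    (h : ∀ a, Normal a → coords K c a ≠ 0 → word K a ∈ J) : c ∈ J := by
  rw [← ofCoords_coords K c, ofCoords, Finsupp.linearCombination_apply]
  refine Submodule.sum_mem _ fun a ha => ?_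
  have ha : coords K c a ≠ 0 := by simpa using ha
  dsimp only
  rw [Algebra.smul_def]
  refine J.mul_mem_left _ (h a ?_ ha)
  by_contra hn
  exact ha (coords_of_not_normal K hn c)

/-- The left ideal of `A` generated by a finite set of words. -/
noncomputable def wordIdeal (B : Finset (List Gen)) : Ideal (A K) := Ideal.span (word K '' B)

variable {K} in
lemma word_mem_wordIdeal {B : Finset (List Gen)} {b : List Gen} (hb : b ∈ B) :
    word K b ∈ wordIdeal K B :=
  Ideal.subset_span ⟨b, hb, rfl⟩

lemma mem_wordIdeal_singleton {a : List Gen} {c : A K} :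
    c ∈ wordIdeal K {a} ↔ ∃ r, r * word K a = c := by
  simp [wordIdeal, Ideal.mem_span_singleton']

/-- A combinatorial criterion for the set of words `B` to generate the left annihilator of the
word `a`. -/
def Annihilates (B : Finset (List Gen)) (a : List Gen) : Prop :=
  Normal a ∧ (∀ b ∈ B, ¬ Normal (b ++ a)) ∧
    ∀ R ∈ relWords, ∀ k < R.length, R.drop k <+: a → ∃ b ∈ B, b <:+ R.take k

instance (B : Finset (List Gen)) (a : List Gen) : Decidable (Annihilates B a) := by
  unfold Annihilates; infer_instance

lemma Annihilates.exists_suffix {B : Finset (List Gen)} {a c : List Gen} (h : Annihilates B a)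
    (hc : Normal c) (hca : ¬ Normal (c ++ a)) : ∃ b ∈ B, b <:+ c := by
  simp only [Normal, not_forall, not_not] at hca
  obtain ⟨R, hR, hRca⟩ := hca
  obtain hRc | hRa | ⟨t₁, t₂, rfl, h₁, h₂⟩ := List.infix_append_iff.1 hRca
  · exact absurd hRc (hc R hR)
  · exact absurd hRa (h.1 R hR)
  · by_cases ht : t₂ = []
    · subst ht
      exact absurd (by simpa using h₁.isInfix) (hc _ hR)
    · obtain ⟨b, hb, hbt⟩ := h.2.2 _ hR t₁.length
        (by simpa [List.length_pos_iff] using ht) (by simpa using h₂)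
      exact ⟨b, hb, (by simpa using hbt : b <:+ t₁).trans h₁⟩

lemma Annihilates.mem_wordIdeal_iff {B : Finset (List Gen)} {a : List Gen} (h : Annihilates B a)
    (c : A K) : c ∈ wordIdeal K B ↔ c * word K a = 0 := by
  constructor
  · intro hc
    induction hc using Submodule.span_induction with
    | mem c hc =>
      obtain ⟨b, hb, rfl⟩ := hc
      rw [← word_append, word_eq_zero K (h.2.1 b hb)]
    | zero => simp
    | add c d _ _ hc hd => rw [add_mul, hc, hd, add_zero]
    | smul r c _ hc => rw [smul_eq_mul, mul_assoc, hc, mul_zero]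
  · intro hc
    refine mem_of_coords K _ c fun d hd hcd => ?_
    obtain ⟨b, hb, e, rfl⟩ := h.exists_suffix hd fun hda => hcd <| by
      rw [← coords_mul_word K hda, hc]; simp
    rw [word_append]
    exact Ideal.mul_mem_left _ _ (word_mem_wordIdeal hb)

lemma coords_eq_zero_of_mem {B : Finset (List Gen)} {a b : List Gen} (h : Annihilates B a)
    (hba : Normal (b ++ a)) {c : A K} (hc : c ∈ wordIdeal K B) : coords K c b = 0 := by
  rw [← coords_mul_word K hba, (h.mem_wordIdeal_iff K c).1 hc]; simp

/-- The words consisting of a single letter. -/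
def letters : Finset (List Gen) := Finset.univ.image fun i => [i]

lemma singleton_mem_letters (i : Gen) : [i] ∈ letters := by simp [letters]

lemma mem_wordIdeal_letters (c : A K) : c ∈ wordIdeal K letters ↔ aug K c = 0 := by
  constructor
  · intro hc
    induction hc using Submodule.span_induction with
    | mem c hc =>
      obtain ⟨b, hb, rfl⟩ := hc
      obtain ⟨i, rfl⟩ : ∃ i, [i] = b := by simpa [letters] using hb
      simp
    | zero => simp
    | add c d _ _ hc hd => rw [map_add, hc, hd, add_zero]
    | smul r c _ hc => rw [smul_eq_mul, map_mul, hc, mul_zero]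
  · intro hc
    refine mem_of_coords K _ c fun d _ hcd => ?_
    obtain rfl | ⟨a, i, rfl⟩ := d.eq_nil_or_concat'
    · exact absurd (by rw [coords_nil, hc]) hcd
    · rw [word_append]
      exact Ideal.mul_mem_left _ _ (word_mem_wordIdeal (singleton_mem_letters i))

variable {K} in
lemma wordIdeal_singleton_le {a b : List Gen} (h : b <:+ a) :
    wordIdeal K {a} ≤ wordIdeal K {b} := by
  intro c hc
  obtain ⟨r, rfl⟩ := (mem_wordIdeal_singleton K).1 hc
  obtain ⟨d, rfl⟩ := h
  exact (mem_wordIdeal_singleton K).2 ⟨r * word K d, by rw [word_append, mul_assoc]⟩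

/-- The part of an element of `A` consisting of the words with a given last letter. -/
noncomputable def lastPart (o : Option Gen) : A K →ₗ[K] A K :=
  ofCoords K ∘ₗ Finsupp.linearCombination K
    (fun a => if a.getLast? = o then Finsupp.single a (1 : K) else 0) ∘ₗ coords K

lemma lastPart_word (o : Option Gen) (a : List Gen) :
    lastPart K o (word K a) = if a.getLast? = o then word K a else 0 := by
  by_cases ha : Normal a
  · simp only [lastPart, LinearMap.coe_comp, Function.comp_apply, coords_word, if_pos ha,
      Finsupp.linearCombination_single, one_smul]
    split_ifs <;> simp
  · simp [word_eq_zero K ha]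

lemma lastPart_mul_word (o : Option Gen) {a : List Gen} (ha : a ≠ []) (c : A K) :
    lastPart K o (c * word K a) = c * lastPart K o (word K a) := by
  suffices lastPart K o ∘ₗ LinearMap.mulRight K (word K a) =
    LinearMap.mulRight K (lastPart K o (word K a)) from LinearMap.congr_fun this c
  refine linearMap_ext fun d _ => ?_
  simp only [LinearMap.coe_comp, Function.comp_apply, LinearMap.mulRight_apply, ← word_append,
    lastPart_word, List.getLast?_append_of_ne_nil _ ha]
  split_ifs <;> simp [word_append]

section

variable {B : Finset (List Gen)}

lemma lastPart_mul (o : Option Gen) (hB : [] ∉ B) (r : A K) {c : A K}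
    (hc : c ∈ wordIdeal K B) : lastPart K o (r * c) = r * lastPart K o c := by
  induction hc using Submodule.span_induction generalizing r with
  | mem c hc =>
    obtain ⟨b, hb, rfl⟩ := hc
    exact lastPart_mul_word K o (fun h => hB (h ▸ hb)) r
  | zero => simp
  | add c d _ _ hc hd => rw [mul_add, map_add, hc, hd, map_add, mul_add]
  | smul s c _ hc => rw [smul_eq_mul, ← mul_assoc, hc, hc, mul_assoc]

lemma lastPart_mem (hB : [] ∉ B)
    (hinj : ∀ a ∈ B, ∀ b ∈ B, a.getLast? = b.getLast? → a = b)
    {b : List Gen} (hb : b ∈ B) {c : A K} (hc : c ∈ wordIdeal K B) :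
    lastPart K b.getLast? c ∈ wordIdeal K {b} := by
  induction hc using Submodule.span_induction with
  | mem c hc =>
    obtain ⟨a, ha, rfl⟩ := hc
    rw [lastPart_word]
    split_ifs with h
    · exact hinj a ha b hb h ▸ word_mem_wordIdeal (Finset.mem_singleton_self _)
    · exact zero_mem _
  | zero => simp
  | add c d _ _ hc hd => rw [map_add]; exact add_mem hc hd
  | smul s c hc' hc =>
    rw [smul_eq_mul, lastPart_mul K _ hB _ hc']
    exact Ideal.mul_mem_left _ _ hc

lemma sum_lastPart (hB : [] ∉ B)
    (hinj : ∀ a ∈ B, ∀ b ∈ B, a.getLast? = b.getLast? → a = b)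
    {c : A K} (hc : c ∈ wordIdeal K B) :
    ∑ b : B, lastPart K b.1.getLast? c = c := by
  induction hc using Submodule.span_induction with
  | mem c hc =>
    obtain ⟨a, ha, rfl⟩ := hc
    rw [Finset.sum_eq_single ⟨a, ha⟩]
    · simp [lastPart_word]
    · rintro b - hba
      rw [lastPart_word, if_neg fun h => hba (Subtype.ext (hinj a ha b b.2 h).symm)]
    · simp
  | zero => simp
  | add c d _ _ hc hd => simp only [map_add, Finset.sum_add_distrib, hc, hd]
  | smul s c hc' hc =>
    simp only [smul_eq_mul, lastPart_mul K _ hB _ hc', ← Finset.mul_sum, hc]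

/-- The projection of the ideal generated by words with distinct last letters onto the ideal
generated by one of these words. -/
noncomputable def proj (hB : [] ∉ B)
    (hinj : ∀ a ∈ B, ∀ b ∈ B, a.getLast? = b.getLast? → a = b) (b : B) :
    wordIdeal K B →ₗ[A K] wordIdeal K {b.1} where
  toFun c := ⟨lastPart K b.1.getLast? c, lastPart_mem K hB hinj b.2 c.2⟩
  map_add' _ _ := Subtype.ext (map_add _ _ _)
  map_smul' r c := Subtype.ext (lastPart_mul K _ hB r c.2)

end

lemma smul_kMod (r : A K) (c : K) : (r • (show KMod K from c) : KMod K) = aug K r * c := rfl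

lemma exists_functional (J : Ideal (A K)) (j : Gen) {b : List Gen}
    (hJ : ∀ c ∈ J, coords K c b = 0) (k : KMod K) :
    ∃ f : ModuleCat.of (A K) J ⟶ KMod K, ∀ c : J, f.hom c = coords K c (j :: b) * (show K from k) := by
  have key (r : A K) : ∀ c ∈ J, coords K (r * c) (j :: b) = aug K r * coords K c (j :: b) := by
    induction r using induction_on with
    | scalar x => simp [← Algebra.smul_def]
    | gen i => intro c hc; rw [coords_gen_mul_apply K i c (hJ c hc), aug_gen, zero_mul]
    | mul r s hr hs =>
      intro c hc
      rw [mul_assoc, hr _ (J.mul_mem_left _ hc), hs c hc, map_mul, mul_assoc]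
    | add r s hr hs =>
      intro c hc
      rw [add_mul, map_add, Finsupp.add_apply, hr c hc, hs c hc, map_add, add_mul]
  let f : J →ₗ[A K] KMod K :=
    { toFun := fun c => (show KMod K from (coords K c (j :: b) * (show K from k) : K))
      map_add' := fun c d => by
        have : coords K (c + d : J) (j :: b) = coords K c (j :: b) + coords K d (j :: b) := by simp
        rw [this]
        exact add_mul (R := K) _ _ _
      map_smul' := fun r c => by
        have : coords K (r • c : J) (j :: b) = _ := key r c c.2
        rw [this, RingHom.id_apply, smul_kMod]
        exact mul_assoc (G := K) _ _ _ }
  exact ⟨ModuleCat.ofHom (Y := KMod K) f, fun _ => rfl⟩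

section Ext

open Abelian

/-- The classes of degree `i` generated by products with a class of `E¹(A)` or `E²(A)`. -/
noncomputable def decomposables (M : ModuleCat.{0} (A K)) (i : ℕ) :
    AddSubgroup (Ext M (KMod K) i) :=
  AddSubgroup.closure
    {x | (∃ (j : ℕ) (h : j + 1 = i) (a : Ext M (KMod K) j) (b : E K 1), x = a.comp b h) ∨
      ∃ (j : ℕ) (h : j + 2 = i) (a : Ext M (KMod K) j) (b : E K 2), x = a.comp b h}

/-- All classes of degree at least `k` are generated by products with a class of
`E¹(A)` or `E²(A)`. -/
def Generated (M : ModuleCat.{0} (A K)) (k : ℕ) : Prop :=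
  ∀ i, k ≤ i → ∀ x : Ext M (KMod K) i, x ∈ decomposables K M i

variable {K}

lemma comp_mem_decomposables {M M' : ModuleCat.{0} (A K)} {i j k : ℕ} (a : Ext M M' i)
    {x : Ext M' (KMod K) j} (hx : x ∈ decomposables K M' j) (h : i + j = k) :
    a.comp x h ∈ decomposables K M k := by
  induction hx using AddSubgroup.closure_induction with
  | mem x hx =>
    refine AddSubgroup.subset_closure ?_
    obtain ⟨l, hl, b, c, rfl⟩ | ⟨l, hl, b, c, rfl⟩ := hx
    · exact .inl ⟨i + l, by omega, a.comp b rfl, c,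
        (Ext.comp_assoc a b c rfl hl (by omega)).symm⟩
    · exact .inr ⟨i + l, by omega, a.comp b rfl, c,
        (Ext.comp_assoc a b c rfl hl (by omega)).symm⟩
  | zero => rw [Ext.comp_zero]; exact zero_mem _
  | add x y _ _ hx hy => rw [Ext.comp_add]; exact add_mem hx hy
  | neg x _ hx => rw [Ext.comp_neg]; exact neg_mem hx

lemma Generated.of_retracts {M : ModuleCat.{0} (A K)} {ι : Type} [Fintype ι]
    {N : ι → ModuleCat.{0} (A K)} (f : ∀ i, M ⟶ N i) (f' : ∀ i, N i ⟶ M)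
    (hf : ∑ i, f i ≫ f' i = 𝟙 M) {k : ℕ} (hN : ∀ i, Generated K (N i) k) : Generated K M k := by
  intro i hi x
  rw [← Ext.mk₀_id_comp x, ← hf, Ext.mk₀_sum, Ext.sum_comp]
  refine sum_mem fun j _ => ?_
  rw [← Ext.mk₀_comp_mk₀, Ext.comp_assoc_of_second_deg_zero]
  exact comp_mem_decomposables _ (hN j i hi _) _

/-- The module `M` is generated by `e`, with annihilator `J`. -/
structure IsPresented (M : ModuleCat.{0} (A K)) (e : M) (J : Ideal (A K)) : Prop where
  exists_smul : ∀ x, ∃ r : A K, r • e = x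
  mem_iff : ∀ r, r ∈ J ↔ r • e = 0

namespace IsPresented

variable {M M' : ModuleCat.{0} (A K)} {e : M} {e' : M'} {J J' : Ideal (A K)}

/-- The short exact sequence `0 → J → A → M → 0`. -/
noncomputable abbrev seq (h : IsPresented M e J) : ShortComplex (ModuleCat.{0} (A K)) :=
  ShortComplex.mk (X₁ := ModuleCat.of (A K) J) (X₂ := ModuleCat.of (A K) (A K)) (X₃ := M)
    (ModuleCat.ofHom J.subtype) (ModuleCat.ofHom (LinearMap.toSpanSingleton (A K) M e)) (by
      ext r
      simpa using (h.mem_iff r).1 r.2)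

lemma shortExact (h : IsPresented M e J) : h.seq.ShortExact where
  exact := by
    rw [ShortComplex.moduleCat_exact_iff]
    intro r hr
    exact ⟨⟨r, (h.mem_iff r).2 (by simpa using hr)⟩, rfl⟩
  mono_f := (ModuleCat.mono_iff_injective _).2 J.subtype_injective
  epi_g := (ModuleCat.epi_iff_surjective _).2 fun x => (h.exists_smul x).imp fun r hr => by
    simpa using hr

/-- The class of the extension `0 → J → A → M → 0`. -/
noncomputable def δ (h : IsPresented M e J) : Ext M (ModuleCat.of (A K) J) 1 :=
  h.shortExact.extClass

lemma exists_δ_comp (h : IsPresented M e J) {N : ModuleCat.{0} (A K)} {i j : ℕ}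
    (x : Ext M N j) (hij : 1 + i = j) :
    ∃ y : Ext (ModuleCat.of (A K) J) N i, h.δ.comp y hij = x := by
  refine Ext.contravariant_sequence_exact₃ h.shortExact N x ?_ hij
  have : Projective (ModuleCat.of (A K) (A K)) :=
    (IsProjective.iff_projective (R := A K) (P := A K)).1 inferInstance
  obtain rfl : j = i + 1 := by omega
  exact Ext.eq_zero_of_projective _

lemma exists_desc (h : IsPresented M e J) (x : M') (hx : ∀ r ∈ J, r • x = 0) :
    ∃ f : M ⟶ M', f.hom e = x := by
  have hs : Function.Surjective (LinearMap.toSpanSingleton (A K) M e) := fun y =>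
    (h.exists_smul y).imp fun r hr => by simpa using hr
  let f := ((LinearMap.toSpanSingleton (A K) M e).ker.liftQ
    (LinearMap.toSpanSingleton (A K) M' x) fun r hr => by
      simpa using hx r ((h.mem_iff r).2 (by simpa using hr))) ∘ₗ
    ((LinearMap.toSpanSingleton (A K) M e).quotKerEquivOfSurjective hs).symm.toLinearMap
  refine ⟨ModuleCat.ofHom f, ?_⟩
  have : ((LinearMap.toSpanSingleton (A K) M e).quotKerEquivOfSurjective hs).symm e =
      Submodule.Quotient.mk 1 := by
    rw [LinearEquiv.symm_apply_eq]; simp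
  simp [f, this]

lemma naturality (h : IsPresented M e J) (h' : IsPresented M' e' J') (f : M ⟶ M') (s : A K)
    (hf : f.hom e = s • e') :
    ∃ ψ : J →ₗ[A K] J', (∀ c, (ψ c : A K) = c * s) ∧
      h.δ.comp (Ext.mk₀ (ModuleCat.ofHom ψ)) (add_zero 1) =
        (Ext.mk₀ f).comp h'.δ (zero_add 1) := by
  let ψ : J →ₗ[A K] J' := (LinearMap.toSpanSingleton (A K) (A K) s).restrict fun r hr => by
    rw [h'.mem_iff, LinearMap.toSpanSingleton_apply, smul_eq_mul, mul_smul, ← hf, ← map_smul,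
      (h.mem_iff r).1 hr, map_zero]
  refine ⟨ψ, fun _ => rfl, ?_⟩
  let φ : h.seq ⟶ h'.seq :=
    { τ₁ := ModuleCat.ofHom ψ
      τ₂ := ModuleCat.ofHom (LinearMap.toSpanSingleton (A K) (A K) s)
      τ₃ := f
      comm₁₂ := by ext r; rfl
      comm₂₃ := by
        ext
        simp [hf] }
  exact ShortComplex.ShortExact.extClass_naturality h.shortExact h'.shortExact φ

lemma generated_succ (h : IsPresented M e J) {k : ℕ}
    (hJ : Generated K (ModuleCat.of (A K) J) k) : Generated K M (k + 1) := by
  intro i hi x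
  obtain ⟨y, rfl⟩ := h.exists_δ_comp x (show 1 + (i - 1) = i by omega)
  exact comp_mem_decomposables _ (hJ _ (by omega) y) _

end IsPresented



/-- The left ideal generated by a set of words, as an object of the category of modules. -/
noncomputable abbrev idealMod (B : Finset (List Gen)) : ModuleCat.{0} (A K) :=
  ModuleCat.of (A K) (wordIdeal K B)

lemma isPresented_kMod :
    IsPresented (KMod K) (show KMod K from (1 : K)) (wordIdeal K letters) where
  exists_smul x := ⟨algebraMap K (A K) (show K from x), by
    rw [smul_kMod, AlgHom.commutes, mul_one]; rfl⟩
  mem_iff r := by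
    rw [mem_wordIdeal_letters, smul_kMod, mul_one]; rfl

variable (K) in
lemma Annihilates.isPresented {B : Finset (List Gen)} {a : List Gen} (h : Annihilates B a) :
    IsPresented (idealMod (K := K) {a})
      ⟨word K a, word_mem_wordIdeal (Finset.mem_singleton_self a)⟩ (wordIdeal K B) where
  exists_smul := by
    rintro ⟨x, hx⟩
    obtain ⟨r, rfl⟩ := (mem_wordIdeal_singleton K).1 hx
    exact ⟨r, rfl⟩
  mem_iff r := by
    rw [h.mem_wordIdeal_iff K, Subtype.ext_iff]; rfl

lemma wordIdeal_singleton_hom_ext {a : List Gen} {N : ModuleCat.{0} (A K)}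
    {f f' : idealMod (K := K) {a} ⟶ N}
    (h : f.hom ⟨word K a, word_mem_wordIdeal (Finset.mem_singleton_self a)⟩ =
      f'.hom ⟨word K a, word_mem_wordIdeal (Finset.mem_singleton_self a)⟩) : f = f' := by
  ext ⟨x, hx⟩
  obtain ⟨r, rfl⟩ := (mem_wordIdeal_singleton K).1 hx
  have key (φ : idealMod (K := K) {a} ⟶ N) : φ.hom ⟨r * word K a, hx⟩ =
      r • φ.hom ⟨word K a, word_mem_wordIdeal (Finset.mem_singleton_self a)⟩ := by
    rw [← map_smul]; rfl
  exact (key f).trans ((congrArg _ h).trans (key f').symm)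

lemma generated_of_lastLetters {B : Finset (List Gen)} {k : ℕ} (hB : [] ∉ B)
    (hinj : ∀ a ∈ B, ∀ b ∈ B, a.getLast? = b.getLast? → a = b)
    (h : ∀ b ∈ B, Generated K (idealMod {b}) k) : Generated K (idealMod B) k := by
  refine Generated.of_retracts (N := fun b : B => idealMod {b.1})
    (fun b => ModuleCat.ofHom (proj K hB hinj b))
    (fun b => ModuleCat.ofHom (Submodule.inclusion
      (Ideal.span_mono (Set.image_mono (by simp))))) ?_ fun b => h b b.2
  ext c
  simp only [ModuleCat.hom_sum, LinearMap.sum_apply, AddSubmonoidClass.coe_finsetSum]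
  exact sum_lastPart K hB hinj c.2

lemma generated_of_annihilates_empty {a : List Gen} (h : Annihilates ∅ a) :
    Generated K (idealMod {a}) 1 := by
  refine (h.isPresented K).generated_succ fun i _ x => ?_
  have : Subsingleton (wordIdeal K ∅) := by
    rw [wordIdeal, Finset.coe_empty, Set.image_empty, Ideal.span_empty]; infer_instance
  have h0 : Limits.IsZero (idealMod (K := K) ∅) := ModuleCat.isZero_of_subsingleton _
  rw [← Ext.mk₀_id_comp x, h0.eq_of_src (𝟙 _) 0, Ext.mk₀_zero, Ext.zero_comp]
  exact zero_mem _

lemma generated_one_of_letter {a : List Gen} {l : Gen} (h : Annihilates {[l]} a)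
    (ha : Generated K (idealMod {a}) 2) : Generated K (idealMod {a}) 1 := by
  intro i hi x
  obtain hi | rfl := hi.lt_or_eq
  · exact ha i hi x
  have hp := h.isPresented K
  obtain ⟨y, rfl⟩ := hp.exists_δ_comp x (add_zero 1)
  obtain ⟨f, rfl⟩ := Ext.mk₀_bijective _ _ |>.2 y
  obtain ⟨π, hπ⟩ := hp.exists_desc (M' := KMod K) (show KMod K from (1 : K)) fun r hr =>
    (isPresented_kMod.mem_iff r).1
      (Ideal.span_mono (Set.image_mono (by simp [singleton_mem_letters])) hr)
  obtain ⟨ψ, hψ, hδ⟩ := hp.naturality isPresented_kMod π 1 (by rw [hπ, one_smul])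
  obtain ⟨φ, hφ⟩ := exists_functional K (wordIdeal K letters) l (b := [])
    (fun c hc => by rw [coords_nil]; exact (mem_wordIdeal_letters K c).1 hc)
    (f.hom ⟨word K [l], word_mem_wordIdeal (Finset.mem_singleton_self _)⟩)
  have hf : f = ModuleCat.ofHom ψ ≫ φ := by
    refine wordIdeal_singleton_hom_ext ?_
    rw [ModuleCat.hom_comp, LinearMap.comp_apply, ModuleCat.hom_ofHom, hφ, hψ,
      mul_one, coords_word, if_pos (by cases l <;> decide), Finsupp.single_eq_same, one_mul]
  rw [hf, ← Ext.mk₀_comp_mk₀, ← Ext.comp_assoc_of_third_deg_zero, hδ,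
    Ext.comp_assoc_of_third_deg_zero]
  exact AddSubgroup.subset_closure (.inl ⟨0, rfl, _, _, rfl⟩)

lemma generated_two_of_relation {a b c : List Gen} {B : Finset (List Gen)} {i l : Gen}
    (hab : Annihilates {b ++ [l]} a) (hbc : Annihilates {i :: c} (b ++ [l]))
    (hl : Annihilates B [l]) (hN : Normal (i :: c ++ b)) (hN' : Normal (c ++ (b ++ [l])))
    (hb : Generated K (idealMod {b ++ [l]}) 2) : Generated K (idealMod {a}) 2 := by
  intro k hk x
  obtain hk | rfl := hk.lt_or_eq
  · exact (hab.isPresented K).generated_succ hb k hk x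
  have hp := hab.isPresented K
  have hq := hbc.isPresented K
  have hr := hl.isPresented K
  obtain ⟨y, rfl⟩ := hp.exists_δ_comp x (show 1 + 1 = 2 from rfl)
  obtain ⟨y, rfl⟩ := hq.exists_δ_comp y (add_zero 1)
  obtain ⟨f, rfl⟩ := Ext.mk₀_bijective _ _ |>.2 y
  have hle : wordIdeal K {b ++ [l]} ≤ wordIdeal K letters :=
    (wordIdeal_singleton_le (List.suffix_append b [l])).trans
      (Ideal.span_mono (Set.image_mono (by simp [singleton_mem_letters])))
  obtain ⟨π, hπ⟩ := hp.exists_desc (M' := KMod K) (show KMod K from (1 : K)) fun r hr =>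
    (isPresented_kMod.mem_iff r).1 (hle hr)
  obtain ⟨ψ, hψ, hδ⟩ := hp.naturality isPresented_kMod π 1 (by rw [hπ, one_smul])
  let p : idealMod (K := K) letters ⟶ idealMod {[l]} := ModuleCat.ofHom
    (proj K (by decide) (by decide) ⟨[l], singleton_mem_letters l⟩)
  obtain ⟨ψ', hψ', hδ'⟩ := hq.naturality hr (ModuleCat.ofHom ψ ≫ p) (word K b) (by
    refine Subtype.ext ?_
    change lastPart K _ (ψ _ : A K) = word K b * word K [l]
    rw [hψ, mul_one, lastPart_word, if_pos (by simp), word_append])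
  obtain ⟨φ, hφ⟩ := exists_functional K (wordIdeal K B) i (b := c ++ b)
    (fun d hd => coords_eq_zero_of_mem K hl (by simpa using hN') hd)
    (f.hom ⟨word K (i :: c), word_mem_wordIdeal (Finset.mem_singleton_self _)⟩)
  have hf : f = ModuleCat.ofHom ψ' ≫ φ := by
    refine wordIdeal_singleton_hom_ext ?_
    rw [ModuleCat.hom_comp, LinearMap.comp_apply, ModuleCat.hom_ofHom, hφ,
      hψ', ← word_append, coords_word, if_pos hN, List.cons_append, Finsupp.single_eq_same,
      one_mul]
  have h₁ : hq.δ.comp (Ext.mk₀ f) (add_zero 1) = (Ext.mk₀ (ModuleCat.ofHom ψ)).comp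
      ((Ext.mk₀ p).comp (hr.δ.comp (Ext.mk₀ φ) (add_zero 1)) (zero_add 1)) (zero_add 1) := by
    rw [hf, ← Ext.mk₀_comp_mk₀, ← Ext.comp_assoc_of_third_deg_zero, hδ',
      Ext.comp_assoc_of_third_deg_zero, ← Ext.mk₀_comp_mk₀, Ext.comp_assoc_of_second_deg_zero]
  have h₂ : hp.δ.comp (hq.δ.comp (Ext.mk₀ f) (add_zero 1)) rfl =
      (Ext.mk₀ π).comp (isPresented_kMod.δ.comp ((Ext.mk₀ p).comp
        (hr.δ.comp (Ext.mk₀ φ) (add_zero 1)) (zero_add 1)) rfl) (zero_add 2) := by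
    rw [h₁, ← Ext.comp_assoc_of_second_deg_zero, hδ]
    exact Ext.comp_assoc _ _ _ _ _ (by omega)
  rw [h₂]
  exact AddSubgroup.subset_closure (.inr ⟨0, rfl, _, _, rfl⟩)

lemma generated_two {a : List Gen} {B : Finset (List Gen)} (h : Annihilates B a)
    (hB : Generated K (idealMod B) 1) : Generated K (idealMod {a}) 2 :=
  (h.isPresented K).generated_succ hB

variable (K) in
lemma generated_letter (i : Gen) : Generated K (idealMod {[i]}) 2 := by
  have terminal {a : List Gen} (h : Annihilates ∅ a := by decide) :
      Generated K (idealMod {a}) 1 := generated_of_annihilates_empty h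
  have terminal_two {a : List Gen} (h : Annihilates ∅ a := by decide) :
      Generated K (idealMod {a}) 2 := fun i hi => terminal h i (by omega)
  have npqr : Generated K (idealMod {[n, p, q, r]}) 1 :=
    generated_one_of_letter (l := n) (by decide) (generated_two (B := {[n]}) (by decide) terminal)
  have nnpq : Generated K (idealMod {[n, n, p, q]}) 1 :=
    generated_one_of_letter (l := m) (by decide) (generated_two (B := {[m]}) (by decide) terminal)
  have pqrs : Generated K (idealMod {[p, q, r, s]}) 1 :=
    generated_one_of_letter (l := n) (by decide) (generated_two (B := {[n]}) (by decide) terminal)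
  have pqr : Generated K (idealMod {[p, q, r]}) 2 :=
    generated_two (B := {[n, n]}) (by decide) terminal
  have st : Generated K (idealMod {[s, t]}) 2 :=
    generated_two_of_relation (b := [p, q]) (l := r) (i := n) (c := [n]) (B := {[n, n, p, q]})
      (by decide) (by decide) (by decide) (by decide) (by decide) pqr
  have hs : Generated K (idealMod {[s]}) 2 :=
    generated_two (B := {[n, p, q, r]}) (by decide) npqr
  have ht : Generated K (idealMod {[t]}) 2 :=
    generated_two (B := {[p, q, r, s]}) (by decide) pqrs
  have hu : Generated K (idealMod {[u]}) 2 :=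
    generated_two_of_relation (b := [s]) (l := t) (i := p) (c := [q, r]) (B := {[p, q, r, s]})
      (by decide) (by decide) (by decide) (by decide) (by decide) st
  have tuvw : Generated K (idealMod {[t, u, v, w]}) 1 :=
    generated_one_of_letter (l := s) (by decide) <|
      generated_two_of_relation (b := []) (l := s) (i := n) (c := [p, q, r])
        (B := {[n, p, q, r]}) (by decide) (by decide) (by decide) (by decide) (by decide) hs
  have uvwx : Generated K (idealMod {[u, v, w, x]}) 1 :=
    generated_one_of_letter (l := t) (by decide) <|
      generated_two_of_relation (b := []) (l := t) (i := p) (c := [q, r, s])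
        (B := {[p, q, r, s]}) (by decide) (by decide) (by decide) (by decide) (by decide) ht
  have vwxy : Generated K (idealMod {[v, w, x, y]}) 1 :=
    generated_one_of_letter (l := u) (by decide) <|
      generated_two_of_relation (b := []) (l := u) (i := s) (c := [t])
        (B := {[s, t]}) (by decide) (by decide) (by decide) (by decide) (by decide) hu
  have xyy : Generated K (idealMod {[x, y, y]}) 2 :=
    generated_two (B := {[v, w]}) (by decide) terminal
  cases i with
  | m => exact terminal_two
  | n => exact terminal_two
  | p => exact generated_two (B := {[m, n, n]}) (by decide) terminal
  | q => exact terminal_two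
  | r => exact generated_two (B := {[n, n, p, q]}) (by decide) nnpq
  | s => exact hs
  | t => exact ht
  | u => exact hu
  | v => exact terminal_two
  | w => exact terminal_two
  | x => exact generated_two (B := {[t, u, v, w]}) (by decide) tuvw
  | y =>
    refine generated_two (B := {[u, v, w, x], [v, w, x, y]}) (by decide) ?_
    refine generated_of_lastLetters (by decide) (by decide) fun b hb => ?_
    simp only [Finset.mem_insert, Finset.mem_singleton] at hb
    obtain rfl | rfl := hb
    · exact uvwx
    · exact vwxy
  | z =>
    exact generated_two_of_relation (b := [x, y]) (l := y) (i := v) (c := [w])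
      (B := {[u, v, w, x], [v, w, x, y]})
      (by decide) (by decide) (by decide) (by decide) (by decide) xyy

variable (K) in
lemma generated_kMod : Generated K (KMod K) 3 := by
  refine isPresented_kMod.generated_succ ?_
  refine generated_of_lastLetters (by decide) (by decide) fun b hb => ?_
  obtain ⟨i, rfl⟩ : ∃ i, [i] = b := by simpa [letters] using hb
  exact generated_letter K i

end Ext

end MonomialAlgebra

/-- `A` is a `K₂` algebra: the Yoneda algebra
`E(A) = ⊕ₙ Extᴬⁿ(K,K)` is generated as a `K`-algebra by `E¹(A)` and `E²(A)`;
equivalently, for every `n ≥ 3`, `Extᴬⁿ(K,K)` is spanned over `K` by the Yoneda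
products of a class in `Extᴬⁿ⁻¹(K,K)` with a class in `Extᴬ¹(K,K)` together with
the Yoneda products of a class in `Extᴬⁿ⁻²(K,K)` with a class in `Extᴬ²(K,K)`. -/
theorem statement_0 (n : ℕ) (hn : 3 ≤ n) :
    Submodule.span K
      ({x : E K n | ∃ (a : E K (n - 1)) (b : E K 1), x = a.comp b (by omega)} ∪
       {x : E K n | ∃ (a : E K (n - 2)) (b : E K 2), x = a.comp b (by omega)}) = ⊤ := by
  refine eq_top_iff.2 fun a _ => ?_
  have h := MonomialAlgebra.generated_kMod K n hn a
  induction h using AddSubgroup.closure_induction with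
  | mem a ha =>
    refine Submodule.subset_span ?_
    obtain ⟨j, rfl, b, c, rfl⟩ | ⟨j, rfl, b, c, rfl⟩ := ha
    · exact .inl ⟨b, c, rfl⟩
    · exact .inr ⟨b, c, rfl⟩
  | zero => exact zero_mem _
  | add a b _ _ ha hb => exact add_mem (ha trivial) (hb trivial)
  | neg a _ ha => exact neg_mem (ha trivial)
end

section
/- Let A be the monomial algebra on 13 generators defined below and K the trivial A-module. Then dim_K Extᴬ⁵(K,K) = 3. -/
/-!
Let `K` be a field and `V` a 13-dimensional `K`-vector space with basis
`{m,n,p,q,r,s,t,u,v,w,x,y,z}`.  Let `A = T(V)/I` be the quotient of the free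
(tensor) algebra on `V` by the two-sided ideal generated by the nine monomials
`mn²p, n²pqr, npqrs, pqrst, stu, tuvwx, uvwxy, vwxy², xy²z`, and regard `K` as
the trivial left `A`-module via the augmentation sending every generator to `0`.
-/

open CategoryTheory

variable (K : Type) [Field K]

open Gen

/-- The `K`-vector space `Extᴬⁿ(K, K)`. -/
noncomputable def extKK (n : ℕ) : ModuleCat K :=
  ((Ext K (ModuleCat.{0} (A K)) n).obj (Opposite.op (KMod K))).obj (KMod K)


noncomputable section

namespace MonomialExt

instance : DecidableEq Gen := fun a b =>
  decidable_of_iff (a.ctorIdx = b.ctorIdx) (by cases a <;> cases b <;> simp [Gen.ctorIdx])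

/-! ### Combinatorics of words -/

/-- The nine defining monomials of `A`, as words. -/
def obstructions : List (List Gen) :=
  [[m, n, n, p], [n, n, p, q, r], [n, p, q, r, s], [p, q, r, s, t], [s, t, u],
    [t, u, v, w, x], [u, v, w, x, y], [v, w, x, y, y], [x, y, y, z]]

/-- A word is normal if it contains no obstruction. -/
def Normal (l : List Gen) : Prop := ∀ o ∈ obstructions, ¬ o <:+: l

instance : DecidablePred Normal := fun l =>
  inferInstanceAs (Decidable (∀ o ∈ obstructions, ¬ o <:+: l))

/-- The words obtained from an obstruction by removing a nonempty proper end that is a prefix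
of `l`. -/
def overlaps (l : List Gen) : List (List Gen) :=
  obstructions.flatMap fun o =>
    ((List.range o.length).filter fun k => k ≠ 0 ∧ o.drop k <+: l).map o.take

/-- The words indexing the minimal generators of the left annihilator of the word `l` (for `l = []`
of the augmentation ideal). -/
def tails (l : List Gen) : List (List Gen) :=
  if l = [] then [[m], [n], [p], [q], [r], [s], [t], [u], [v], [w], [x], [y], [z]]
  else (overlaps l).filter fun a => ∀ b ∈ overlaps l, b <:+ a → b = a

/-- The chains of length `k`; they index a basis of the `k`-th term of the resolution. -/
def chains : ℕ → List (List (List Gen))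
  | 0 => [[]]
  | k + 1 => (chains k).flatMap fun c => (tails (c.headD [])).map (· :: c)

lemma normal_nil : Normal [] := by decide

lemma Normal.of_infix {a b : List Gen} (h : Normal b) (hab : a <:+: b) : Normal a :=
  fun o ho hoa => h o ho (hoa.trans hab)

lemma mem_overlaps {l a : List Gen} :
    a ∈ overlaps l ↔ ∃ b, b ≠ [] ∧ a ≠ [] ∧ a ++ b ∈ obstructions ∧ b <+: l := by
  simp only [overlaps, List.mem_flatMap, List.mem_map, List.mem_filter, List.mem_range,
    decide_eq_true_eq]
  constructor
  · rintro ⟨o, ho, k, ⟨hk, hk0, hp⟩, rfl⟩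
    refine ⟨o.drop k, by simpa using hk, ?_, by simpa using ho, hp⟩
    rw [Ne, List.take_eq_nil_iff]
    rintro (h | rfl)
    · exact hk0 h
    · simp at hk
  · rintro ⟨b, hb, ha, hab, hp⟩
    refine ⟨a ++ b, hab, a.length, ⟨?_, ?_, ?_⟩, ?_⟩
    · simpa [List.length_pos_iff] using hb
    · simpa using ha
    · simpa using hp
    · simp

lemma normal_of_mem_overlaps {l a : List Gen} (h : a ∈ overlaps l) : Normal a := by
  have key : ∀ o ∈ obstructions, ∀ k ∈ List.range o.length, Normal (o.take k) := by decide +kernel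
  simp only [overlaps, List.mem_flatMap, List.mem_map, List.mem_filter] at h
  obtain ⟨o, ho, k, ⟨hk, -⟩, rfl⟩ := h
  exact key o ho k hk

lemma mem_letters (i : Gen) : [i] ∈ tails [] := by
  cases i <;> decide

lemma mem_tails_nil {a : List Gen} (h : a ∈ tails []) : ∃ i, a = [i] := by
  simp only [tails, if_true, List.mem_cons, List.not_mem_nil, or_false] at h
  rcases h with h | h | h | h | h | h | h | h | h | h | h | h | h <;> exact ⟨_, h⟩

lemma mem_tails {l a : List Gen} (hl : l ≠ []) :
    a ∈ tails l ↔ a ∈ overlaps l ∧ ∀ b ∈ overlaps l, b <:+ a → b = a := by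
  simp [tails, hl]

lemma ne_nil_of_mem_tails {l a : List Gen} (h : a ∈ tails l) : a ≠ [] := by
  by_cases hl : l = []
  · subst hl
    obtain ⟨i, rfl⟩ := mem_tails_nil h
    simp
  · obtain ⟨b, -, ha, -⟩ := mem_overlaps.1 ((mem_tails hl).1 h).1
    exact ha

lemma normal_of_mem_tails {l a : List Gen} (h : a ∈ tails l) : Normal a := by
  by_cases hl : l = []
  · subst hl
    obtain ⟨i, rfl⟩ := mem_tails_nil h
    cases i <;> decide
  · exact normal_of_mem_overlaps ((mem_tails hl).1 h).1

lemma not_normal_append_of_mem_tails {l a : List Gen} (hl : l ≠ []) (h : a ∈ tails l) :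
    ¬ Normal (a ++ l) := by
  obtain ⟨b, -, -, hab, c, rfl⟩ := mem_overlaps.1 ((mem_tails hl).1 h).1
  exact fun hn => hn _ hab ⟨[], c, by simp⟩

lemma eq_of_mem_tails {l a b e : List Gen} (ha : a ∈ tails l) (hb : b ∈ tails l)
    (hae : a <:+ e) (hbe : b <:+ e) : a = b := by
  by_cases hl : l = []
  · subst hl
    obtain ⟨i, rfl⟩ := mem_tails_nil ha
    obtain ⟨j, rfl⟩ := mem_tails_nil hb
    exact (List.suffix_of_suffix_length_le hae hbe (by simp)).eq_of_length (by simp)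
  · rw [mem_tails hl] at ha hb
    rcases List.suffix_or_suffix_of_suffix hae hbe with h | h
    · exact hb.2 a ha.1 h
    · exact (ha.2 b hb.1 h).symm

lemma exists_mem_tails_of_mem_overlaps {l : List Gen} (hl : l ≠ []) :
    ∀ (k : ℕ) (a : List Gen), a.length ≤ k → a ∈ overlaps l → ∃ b ∈ tails l, b <:+ a := by
  intro k
  induction k with
  | zero =>
    intro a hk ha
    obtain ⟨b, -, ha', -⟩ := mem_overlaps.1 ha
    simp_all
  | succ k ih =>
    intro a hk ha
    by_cases hmin : ∀ b ∈ overlaps l, b <:+ a → b = a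
    · exact ⟨a, (mem_tails hl).2 ⟨ha, hmin⟩, List.suffix_rfl⟩
    · push Not at hmin
      obtain ⟨b, hb, hba, hne⟩ := hmin
      have hlt : b.length < a.length :=
        lt_of_le_of_ne hba.length_le fun h => hne (hba.eq_of_length h)
      obtain ⟨c, hc, hcb⟩ := ih b (by omega) hb
      exact ⟨c, hc, hcb.trans hba⟩

lemma exists_mem_tails {l a : List Gen} (hl : l ≠ []) (hln : Normal l) (ha : Normal a)
    (hal : ¬ Normal (a ++ l)) : ∃ b ∈ tails l, b <:+ a := by
  obtain ⟨o, ho, c, e, hce⟩ : ∃ o ∈ obstructions, o <:+: a ++ l := by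
    simpa only [Normal, not_forall, not_not, exists_prop] using hal
  rw [List.append_assoc, List.append_eq_append_iff] at hce
  rcases hce with ⟨f, rfl, hf⟩ | ⟨f, rfl, hf⟩
  · rw [List.append_eq_append_iff] at hf
    rcases hf with ⟨h, rfl, rfl⟩ | ⟨h, rfl, rfl⟩
    · exact absurd ⟨c, h, by simp⟩ (ha o ho)
    · by_cases hf : f = []
      · subst hf
        exact absurd ⟨[], e, by simp⟩ (hln _ ho)
      by_cases hh : h = []
      · subst hh
        exact absurd ⟨c, [], by simp⟩ (ha _ ho)
      obtain ⟨b, hb, hbf⟩ := exists_mem_tails_of_mem_overlaps hl f.length f le_rfl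
        (mem_overlaps.2 ⟨h, hh, hf, ho, e, rfl⟩)
      exact ⟨b, hb, hbf.trans ⟨c, rfl⟩⟩
  · exact absurd ⟨f, e, by simp [hf]⟩ (hln o ho)

lemma cons_mem_chains {k : ℕ} {a : List Gen} {c : List (List Gen)} :
    a :: c ∈ chains (k + 1) ↔ c ∈ chains k ∧ a ∈ tails (c.headD []) := by
  simp [chains]

lemma exists_of_mem_chains {k : ℕ} {c : List (List Gen)} (h : c ∈ chains (k + 1)) :
    ∃ a b, c = a :: b ∧ b ∈ chains k ∧ a ∈ tails (b.headD []) := by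
  simp only [chains, List.mem_flatMap, List.mem_map] at h
  obtain ⟨b, hb, a, ha, rfl⟩ := h
  exact ⟨a, b, rfl, hb, ha⟩

lemma headD_normal {k : ℕ} {c : List (List Gen)} (h : c ∈ chains k) : Normal (c.headD []) := by
  cases k with
  | zero =>
    rw [chains, List.mem_singleton] at h
    subst h
    exact normal_nil
  | succ k =>
    obtain ⟨a, b, rfl, -, ha⟩ := exists_of_mem_chains h
    exact normal_of_mem_tails ha

/-- The chains of length `k`, as a type. -/
abbrev Chain (k : ℕ) : Type := {c : List (List Gen) // c ∈ chains k}

instance (k : ℕ) : Fintype (Chain k) := List.Subtype.fintype _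

/-- The most recent word of a chain, or the empty word for the empty chain. -/
def Chain.head {k : ℕ} (c : Chain k) : List Gen := c.1.headD []

/-- The chain with its most recent word removed. -/
def Chain.tail {k : ℕ} (c : Chain (k + 1)) : Chain k :=
  ⟨c.1.tail, by
    obtain ⟨a, b, h, hb, -⟩ := exists_of_mem_chains c.2
    simpa [h] using hb⟩

/-- Extend a chain by a word. -/
def Chain.cons {k : ℕ} (c : Chain k) (a : List Gen) (ha : a ∈ tails c.head) : Chain (k + 1) :=
  ⟨a :: c.1, cons_mem_chains.2 ⟨c.2, ha⟩⟩

lemma Chain.head_mem {k : ℕ} (c : Chain (k + 1)) : c.head ∈ tails c.tail.head := by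
  obtain ⟨a, b, h, -, ha⟩ := exists_of_mem_chains c.2
  simpa [Chain.head, Chain.tail, h] using ha

lemma Chain.ext_head_tail {k : ℕ} {c e : Chain (k + 1)} (h : c.head = e.head)
    (h' : c.tail = e.tail) : c = e := by
  obtain ⟨a, b, hc, -⟩ := exists_of_mem_chains c.2
  obtain ⟨a', b', he, -⟩ := exists_of_mem_chains e.2
  simp only [Chain.head, hc, he, List.headD_cons, Chain.tail, List.tail_cons,
    Subtype.mk.injEq] at h h'
  exact Subtype.ext (by rw [hc, he, h, h'])

@[simp] lemma Chain.head_cons {k : ℕ} (c : Chain k) (a : List Gen) (ha : a ∈ tails c.head) :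
    (c.cons a ha).head = a := rfl

@[simp] lemma Chain.tail_cons {k : ℕ} (c : Chain k) (a : List Gen) (ha : a ∈ tails c.head) :
    (c.cons a ha).tail = c := rfl

lemma Chain.normal_head {k : ℕ} (c : Chain k) : Normal c.head := headD_normal c.2

lemma Chain.head_ne_nil {k : ℕ} (c : Chain (k + 1)) : c.head ≠ [] :=
  ne_nil_of_mem_tails c.head_mem

lemma card_chain_five : Fintype.card (Chain 5) = 3 := by
  decide +kernel

/-! ### Words as a basis of the algebra -/

/-- The class in `A` of a word. -/
def word (l : List Gen) : A K := RingQuot.mkAlgHom K (MonRel K) (l.map (g K)).prod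

@[simp] lemma word_nil : word K [] = 1 := by simp [word]

lemma word_append (a b : List Gen) : word K (a ++ b) = word K a * word K b := by
  simp [word]

lemma word_eq_zero {l : List Gen} (h : ¬ Normal l) : word K l = 0 := by
  obtain ⟨o, ho, a, b, rfl⟩ : ∃ o ∈ obstructions, o <:+: l := by
    simpa only [Normal, not_forall, not_not, exists_prop] using h
  have h0 : word K o = 0 := by
    rw [word, ← map_zero (RingQuot.mkAlgHom K (MonRel K))]
    apply RingQuot.mkAlgHom_rel
    simp only [obstructions, List.mem_cons, List.not_mem_nil, or_false] at ho
    rcases ho with rfl | rfl | rfl | rfl | rfl | rfl | rfl | rfl | rfl <;>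
      simp only [List.map_cons, List.map_nil, List.prod_cons, List.prod_nil, mul_one,
        ← mul_assoc] <;> constructor
  rw [word_append, word_append, h0, mul_zero, zero_mul]

/-- Left multiplication by a generator on the space with basis all words, where non-normal words
are killed. -/
def step (i : Gen) : Module.End K (List Gen →₀ K) :=
  Finsupp.linearCombination K fun l =>
    if Normal (i :: l) then Finsupp.single (i :: l) (1 : K) else 0

lemma lift_step_single (a b : List Gen) (h : a ≠ [] ∨ Normal b) :
    FreeAlgebra.lift K (step K) (a.map (g K)).prod (Finsupp.single b 1) =
      if Normal (a ++ b) then Finsupp.single (a ++ b) (1 : K) else 0 := by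
  induction a with
  | nil => simp_all
  | cons i a ih =>
    have hi : FreeAlgebra.lift K (step K) (g K i) = step K i := by simp [g]
    by_cases ha : a = []
    · subst ha
      simp [hi, step]
    · rw [List.map_cons, List.prod_cons, map_mul, Module.End.mul_apply, ih (Or.inl ha), hi]
      by_cases hn : Normal (a ++ b)
      · rw [if_pos hn]
        simp [step]
      · have hn' : ¬ Normal (i :: a ++ b) := fun h' => hn (h'.of_infix ⟨[i], [], by simp⟩)
        rw [if_neg hn, if_neg hn', map_zero]

lemma exists_of_monRel {a b : FreeAlgebra K Gen} (h : MonRel K a b) :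
    ∃ o ∈ obstructions, a = (o.map (g K)).prod ∧ b = 0 := by
  cases h
  · exact ⟨[m, n, n, p], by simp [obstructions], by simp [mul_assoc], rfl⟩
  · exact ⟨[n, n, p, q, r], by simp [obstructions], by simp [mul_assoc], rfl⟩
  · exact ⟨[n, p, q, r, s], by simp [obstructions], by simp [mul_assoc], rfl⟩
  · exact ⟨[p, q, r, s, t], by simp [obstructions], by simp [mul_assoc], rfl⟩
  · exact ⟨[s, t, u], by simp [obstructions], by simp [mul_assoc], rfl⟩
  · exact ⟨[t, u, v, w, x], by simp [obstructions], by simp [mul_assoc], rfl⟩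
  · exact ⟨[u, v, w, x, y], by simp [obstructions], by simp [mul_assoc], rfl⟩
  · exact ⟨[v, w, x, y, y], by simp [obstructions], by simp [mul_assoc], rfl⟩
  · exact ⟨[x, y, y, z], by simp [obstructions], by simp [mul_assoc], rfl⟩

/-- The action of `A` on the space with basis all words. -/
def act : A K →ₐ[K] Module.End K (List Gen →₀ K) :=
  RingQuot.liftAlgHom K ⟨FreeAlgebra.lift K (step K), by
    have key : ∀ o ∈ obstructions,
        FreeAlgebra.lift K (step K) (o.map (g K)).prod = 0 := by
      intro o ho
      have hne : o ≠ [] := by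
        rintro rfl
        simp [obstructions] at ho
      ext b : 1
      ext : 1
      have hn : ¬ Normal (o ++ b) := fun h => h o ho ⟨[], b, by simp⟩
      simpa [hn] using lift_step_single K o b (Or.inl hne)
    intro a b h
    obtain ⟨o, ho, rfl, rfl⟩ := exists_of_monRel K h
    rw [key o ho, map_zero]⟩

/-- The coefficients of an element of `A` in the basis of normal words. -/
def coeff : A K →ₗ[K] (List Gen →₀ K) :=
  (LinearMap.applyₗ (Finsupp.single [] (1 : K))).comp (act K).toLinearMap

lemma coeff_word (l : List Gen) :
    coeff K (word K l) = if Normal l then Finsupp.single l (1 : K) else 0 := by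
  have h : act K (word K l) = FreeAlgebra.lift K (step K) (l.map (g K)).prod := by
    simp [act, word]
  simpa [coeff, h] using lift_step_single K l [] (Or.inr normal_nil)

lemma span_range_word : Submodule.span K (Set.range (word K)) = ⊤ := by
  rw [Submodule.eq_top_iff']
  intro a
  obtain ⟨f, rfl⟩ := RingQuot.mkAlgHom_surjective K (MonRel K) a
  induction f using FreeAlgebra.induction with
  | grade0 k =>
    rw [AlgHom.commutes, Algebra.algebraMap_eq_smul_one]
    exact Submodule.smul_mem _ _ (Submodule.subset_span ⟨[], word_nil K⟩)
  | grade1 i => exact Submodule.subset_span ⟨[i], by simp [word, g]⟩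
  | add a b ha hb =>
    rw [map_add]
    exact add_mem ha hb
  | mul a b ha hb =>
    rw [map_mul]
    have hmul := Submodule.mul_mem_mul ha hb
    rw [Submodule.span_mul_span] at hmul
    refine Submodule.span_mono ?_ hmul
    rintro _ ⟨_, ⟨c, rfl⟩, _, ⟨e, rfl⟩, rfl⟩
    exact ⟨c ++ e, word_append K c e⟩

/-- Two linear maps on `A` which agree on all words are equal. -/
lemma linearMap_ext_word {M : Type*} [AddCommGroup M] [Module K M] {f₁ f₂ : A K →ₗ[K] M}
    (h : ∀ l, f₁ (word K l) = f₂ (word K l)) : f₁ = f₂ :=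
  LinearMap.ext_on (span_range_word K) (by rintro _ ⟨l, rfl⟩; exact h l)

lemma linearCombination_coeff (a : A K) :
    Finsupp.linearCombination K (word K) (coeff K a) = a := by
  suffices h : (Finsupp.linearCombination K (word K)).comp (coeff K) = LinearMap.id from
    LinearMap.congr_fun h a
  refine linearMap_ext_word K fun l => ?_
  by_cases hl : Normal l
  · simp [coeff_word, hl]
  · simp [word_eq_zero K hl]

lemma normal_of_coeff_ne_zero {a : A K} {l : List Gen} (h : coeff K a l ≠ 0) : Normal l := by
  by_contra hl
  refine h ?_
  suffices h : (Finsupp.lapply l).comp (coeff K) = 0 from LinearMap.congr_fun h a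
  refine linearMap_ext_word K fun u => ?_
  by_cases hu : Normal u
  · have : u ≠ l := by rintro rfl; exact hl hu
    simp [coeff_word, hu, this]
  · simp [word_eq_zero K hu]

lemma coeff_mul_word_of_not_suffix (a : A K) {b l : List Gen} (h : ¬ b <:+ l) :
    coeff K (a * word K b) l = 0 := by
  suffices h : (Finsupp.lapply l).comp ((coeff K).comp (LinearMap.mulRight K (word K b))) = 0 from
    LinearMap.congr_fun h a
  refine linearMap_ext_word K fun u => ?_
  have hu : u ++ b ≠ l := by rintro rfl; exact h ⟨u, rfl⟩
  by_cases hn : Normal (u ++ b)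
  · simp [← word_append, coeff_word, hn, hu]
  · simp [← word_append, word_eq_zero K hn]

lemma coeff_mul_word_append (a : A K) {b l : List Gen} (h : Normal (l ++ b)) :
    coeff K (a * word K b) (l ++ b) = coeff K a l := by
  suffices h : (Finsupp.lapply (l ++ b)).comp ((coeff K).comp (LinearMap.mulRight K (word K b))) =
      (Finsupp.lapply l).comp (coeff K) from LinearMap.congr_fun h a
  refine linearMap_ext_word K fun u => ?_
  by_cases hul : u = l
  · subst hul
    have hu : Normal u := h.of_infix ⟨[], b, by simp⟩
    simp [← word_append, coeff_word, h, hu]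
  · have h₁ : coeff K (word K (u ++ b)) (l ++ b) = 0 := by
      rw [coeff_word]
      split_ifs <;> simp [hul]
    have h₂ : coeff K (word K u) l = 0 := by
      rw [coeff_word]
      split_ifs <;> simp [hul]
    simp [← word_append, h₁, h₂]

lemma aug_word (l : List Gen) : aug K (word K l) = if l = [] then 1 else 0 := by
  cases l with
  | nil => simp
  | cons i l => simp [aug, word, g]

lemma aug_eq_coeff (a : A K) : aug K a = coeff K a [] := by
  suffices h : (aug K).toLinearMap = (Finsupp.lapply []).comp (coeff K) from
    LinearMap.congr_fun h a
  refine linearMap_ext_word K fun u => ?_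
  by_cases hu : u = []
  · subst hu
    simp [coeff_word, normal_nil, -word_nil, aug_word]
  · have : coeff K (word K u) [] = 0 := by
      rw [coeff_word]
      split_ifs <;> simp [hu]
    simp [aug_word, hu, this]

/-! ### The resolution -/

/-- The differential of the resolution. -/
def diff (k : ℕ) : (Chain (k + 1) →₀ A K) →ₗ[A K] (Chain k →₀ A K) :=
  Finsupp.linearCombination (A K) fun c => Finsupp.single c.tail (word K c.head)

lemma diff_single (k : ℕ) (c : Chain (k + 1)) (a : A K) :
    diff K k (Finsupp.single c a) = Finsupp.single c.tail (a * word K c.head) := by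
  simp [diff]

lemma diff_comp_diff (k : ℕ) : (diff K k).comp (diff K (k + 1)) = 0 := by
  ext c : 2
  have h : ¬ Normal (c.head ++ c.tail.head) :=
    not_normal_append_of_mem_tails c.tail.head_ne_nil c.head_mem
  simp [diff_single, ← word_append, word_eq_zero K h]

lemma diff_apply (k : ℕ) (a : Chain (k + 1) →₀ A K) (c : Chain k) :
    diff K k a c = ∑ e, if e.tail = c then a e * word K e.head else 0 := by
  rw [diff, Finsupp.linearCombination_apply, Finsupp.sum_fintype _ _ (by simp),
    Finsupp.finsetSum_apply]
  refine Finset.sum_congr rfl fun e _ => ?_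
  split_ifs with h <;> simp [h]

/-- Distinct words with the same tail contribute linearly independent terms. -/
lemma mul_word_eq_zero_of_diff_eq_zero {k : ℕ} {a : Chain (k + 1) →₀ A K} (h : diff K k a = 0)
    (c : Chain (k + 1)) : a c * word K c.head = 0 := by
  rw [← linearCombination_coeff K (a c * word K c.head)]
  suffices h0 : coeff K (a c * word K c.head) = 0 by rw [h0, map_zero]
  ext l
  by_cases hl : c.head <:+ l
  · have hsum := congrArg (fun b => coeff K (b c.tail) l) h
    simp only [diff_apply, map_sum, Finsupp.finsetSum_apply, Finsupp.coe_zero, Pi.zero_apply,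
      map_zero] at hsum
    rw [Finset.sum_eq_single c, if_pos rfl] at hsum
    · exact hsum
    · intro e _ hec
      split_ifs with het
      · refine coeff_mul_word_of_not_suffix K _ fun hel => hec (Chain.ext_head_tail ?_ het)
        exact eq_of_mem_tails (het ▸ e.head_mem) c.head_mem hel hl
      · simp
    · simp
  · exact coeff_mul_word_of_not_suffix K _ hl

lemma mem_range_diff {k : ℕ} {a : Chain k →₀ A K}
    (h : ∀ c l, coeff K (a c) l ≠ 0 → ∃ b ∈ tails c.head, b <:+ l) :
    a ∈ LinearMap.range (diff K k) := by
  rw [← a.sum_single]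
  refine Submodule.sum_mem _ fun c _ => ?_
  rw [← linearCombination_coeff K (a c), Finsupp.linearCombination_apply, Finsupp.sum,
    Finsupp.single_finsetSum]
  refine Submodule.sum_mem _ fun l hl => ?_
  obtain ⟨b, hb, u, rfl⟩ := h c l (Finsupp.mem_support_iff.1 hl)
  rw [← Finsupp.smul_single]
  refine Submodule.smul_of_tower_mem _ _ ⟨Finsupp.single (c.cons b hb) (word K u), ?_⟩
  rw [diff_single, Chain.tail_cons, Chain.head_cons, word_append]

lemma mem_range_diff_of_diff_eq_zero {k : ℕ} {a : Chain (k + 1) →₀ A K} (h : diff K k a = 0) :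
    a ∈ LinearMap.range (diff K (k + 1)) := by
  refine mem_range_diff K fun c l hl => ?_
  refine exists_mem_tails c.head_ne_nil c.normal_head (normal_of_coeff_ne_zero K hl) fun hn => hl ?_
  rw [← coeff_mul_word_append K (a c) hn, mul_word_eq_zero_of_diff_eq_zero K h c]
  simp

/-- The identification of `K` with the trivial module. -/
def toKMod : K ≃ KMod K := Equiv.refl K

/-- The augmentation of the resolution. -/
def augmentation : (Chain 0 →₀ A K) →ₗ[A K] KMod K :=
  Finsupp.linearCombination (A K) fun _ => (toKMod K 1)

lemma smul_KMod (a : A K) (k : K) :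
    a • toKMod K k = toKMod K (aug K a * k) := rfl

lemma augmentation_single (c : Chain 0) (a : A K) :
    augmentation K (Finsupp.single c a) = toKMod K (aug K a) := by
  rw [augmentation, Finsupp.linearCombination_single, smul_KMod, mul_one]

lemma word_head_smul {k : ℕ} (c : Chain (k + 1)) (b : KMod K) : word K c.head • b = 0 := by
  obtain ⟨b, rfl⟩ := (toKMod K).surjective b
  rw [smul_KMod, aug_word, if_neg c.head_ne_nil, zero_mul]
  rfl

lemma augmentation_comp_diff : (augmentation K).comp (diff K 0) = 0 := by
  ext c : 2
  rw [LinearMap.comp_apply, LinearMap.comp_apply, Finsupp.lsingle_apply, diff_single, one_mul,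
    augmentation, Finsupp.linearCombination_single, word_head_smul]
  rfl

lemma mem_range_diff_of_augmentation_eq_zero {a : Chain 0 →₀ A K} (h : augmentation K a = 0) :
    a ∈ LinearMap.range (diff K 0) := by
  have hhead (c : Chain 0) : c.1 = [] := by simpa [chains] using c.2
  refine mem_range_diff K fun c l hl => ?_
  have hc : c.head = [] := by simp [Chain.head, hhead c]
  have ha : a = Finsupp.single c (a c) := by
    ext e : 1
    have : e = c := Subtype.ext ((hhead e).trans (hhead c).symm)
    simp [this]
  rw [ha, augmentation_single] at h
  have h0 : coeff K (a c) [] = 0 := (aug_eq_coeff K (a c)).symm.trans h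
  rcases List.eq_nil_or_concat l with rfl | ⟨u, i, rfl⟩
  · exact absurd h0 hl
  · exact ⟨[i], hc ▸ mem_letters i, u, by simp⟩

lemma augmentation_surjective : Function.Surjective (augmentation K) := fun k =>
  ⟨Finsupp.single ⟨[], by simp [chains]⟩ (algebraMap K (A K) k),
    (augmentation_single K _ _).trans ((aug K).commutes k)⟩

/-- The underlying complex of the resolution. -/
def complex : ChainComplex (ModuleCat.{0} (A K)) ℕ :=
  ChainComplex.of (fun k => ModuleCat.of (A K) (Chain k →₀ A K))
    (fun k => ModuleCat.ofHom (diff K k))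
    (fun k => by rw [← ModuleCat.ofHom_comp, diff_comp_diff]; rfl)

lemma complex_d (k : ℕ) : (complex K).d (k + 1) k = ModuleCat.ofHom (diff K k) :=
  ChainComplex.of_d (fun k => ModuleCat.of (A K) (Chain k →₀ A K))
    (fun k => ModuleCat.ofHom (diff K k)) k

lemma complex_d_apply (k : ℕ) (a : Chain (k + 1) →₀ A K) :
    ((complex K).d (k + 1) k).hom a = diff K k a := by
  rw [complex_d]
  rfl

/-- The augmentation, as a morphism of modules. -/
def augmentationHom : (complex K).X 0 ⟶ KMod K :=
  ModuleCat.ofHom (Y := KMod K) (augmentation K)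

/-- The resolution, as a complex over the trivial module. -/
def complexπ : complex K ⟶ (ChainComplex.single₀ _).obj (KMod K) :=
  (ChainComplex.toSingle₀Equiv _ _).symm
    ⟨augmentationHom K, by
      rw [complex_d]
      exact ModuleCat.hom_ext (augmentation_comp_diff K)⟩

lemma complexπ_f_zero : (complexπ K).f 0 = augmentationHom K := by
  simp [complexπ, ChainComplex.toSingle₀Equiv]

lemma complex_exactAt_succ (k : ℕ) : (complex K).ExactAt (k + 1) := by
  rw [HomologicalComplex.exactAt_iff' _ (k + 2) (k + 1) k (by simp) (by simp),
    ShortComplex.moduleCat_exact_iff]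
  intro a ha
  obtain ⟨b, hb⟩ := mem_range_diff_of_diff_eq_zero K ((complex_d_apply K k a).symm.trans ha)
  exact ⟨b, (complex_d_apply K (k + 1) b).trans hb⟩

lemma complexπ_quasiIsoAt_zero : QuasiIsoAt (complexπ K) 0 := by
  rw [ChainComplex.quasiIsoAt₀_iff, ShortComplex.quasiIso_iff_of_zeros' _ ?_ ?_ ?_]
  rotate_left
  iterate 3 rfl
  have hπ (a : Chain 0 →₀ A K) : ((complexπ K).f 0).hom a = augmentation K a := by
    rw [complexπ_f_zero]
    rfl
  constructor
  · rw [ShortComplex.moduleCat_exact_iff]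
    intro a ha
    obtain ⟨b, hb⟩ := mem_range_diff_of_augmentation_eq_zero K ((hπ a).symm.trans ha)
    exact ⟨b, (complex_d_apply K 0 b).trans hb⟩
  · rw [ModuleCat.epi_iff_surjective]
    intro b
    obtain ⟨a, ha⟩ := augmentation_surjective K b
    exact ⟨a, (hπ a).trans ha⟩

/-- A free resolution of the trivial module. -/
def resolution : ProjectiveResolution (KMod K) where
  complex := complex K
  projective k := inferInstanceAs (Projective (ModuleCat.of (A K) (Chain k →₀ A K)))
  π := complexπ K
  quasiIso := ⟨fun k => by
    cases k with
    | zero => exact complexπ_quasiIsoAt_zero K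
    | succ k =>
      rw [quasiIsoAt_iff_exactAt' (hL := ChainComplex.exactAt_succ_single_obj ..)]
      exact complex_exactAt_succ K k⟩

lemma diff_comp_eq_zero {k : ℕ} (f : (Chain k →₀ A K) →ₗ[A K] KMod K) : f.comp (diff K k) = 0 := by
  ext c : 2
  have h : Finsupp.single c.tail (word K c.head) =
      word K c.head • Finsupp.single c.tail (1 : A K) := by simp
  rw [LinearMap.comp_apply, LinearMap.comp_apply, Finsupp.lsingle_apply, diff_single, one_mul, h,
    map_smul, word_head_smul]
  rfl

lemma linearYonedaObj_d (i j : ℕ) :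
    ((complex K).linearYonedaObj K (KMod K)).d i j = 0 := by
  by_cases hij : i + 1 = j
  · subst hij
    refine ModuleCat.hom_ext (LinearMap.ext fun f => ?_)
    refine Eq.trans (b := (complex K).d (i + 1) i ≫ f) rfl ?_
    rw [complex_d]
    exact ModuleCat.hom_ext (diff_comp_eq_zero K f.hom)
  · exact HomologicalComplex.shape _ _ _ hij

/-- The differentials of the complex computing `Ext` vanish, so its homology is the complex
itself. -/
def homologyIso (k : ℕ) : ((complex K).linearYonedaObj K (KMod K)).homology k ≅
    ModuleCat.of K (ModuleCat.of (A K) (Chain k →₀ A K) ⟶ KMod K) :=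
  (ShortComplex.LeftHomologyData.ofZeros
    (((complex K).linearYonedaObj K (KMod K)).sc k)
    (linearYonedaObj_d K _ _) (linearYonedaObj_d K _ _)).homologyIso

/-- Maps from a free module to the trivial module are determined on the basis. -/
def homEquiv (k : ℕ) :
    (ModuleCat.of (A K) (Chain k →₀ A K) ⟶ KMod K) ≃ₗ[K] (Chain k → K) where
  toFun f c := (toKMod K).symm (f.hom (Finsupp.single c 1))
  invFun φ := ModuleCat.ofHom (Y := KMod K)
    (Finsupp.linearCombination (A K) fun c => toKMod K (φ c))
  map_add' f₁ f₂ := rfl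
  map_smul' a f := by
    funext c
    refine (congrArg (toKMod K).symm (smul_KMod K (algebraMap K (A K) a)
      ((toKMod K).symm (f.hom (Finsupp.single c 1))))).trans ?_
    rw [AlgHom.commutes]
    rfl
  left_inv f := by
    refine ModuleCat.hom_ext (Finsupp.lhom_ext' fun c => LinearMap.ext_ring ?_)
    exact (Finsupp.linearCombination_single _ _ _).trans (one_smul _ _)
  right_inv φ := by
    funext c
    have h : Finsupp.linearCombination (A K) (fun c => toKMod K (φ c)) (Finsupp.single c 1) =
        toKMod K (φ c) := by
      rw [Finsupp.linearCombination_single, one_smul]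
    exact (toKMod K).symm_apply_eq.2 h

end MonomialExt

end

/-- `dim_K Extᴬ⁵(K,K) = 3`. -/
theorem statement_6 : Module.finrank K (extKK K 5) = 3 := by
  have e : extKK K 5 ≅ _ :=
    (MonomialExt.resolution K).isoExt 5 (KMod K) ≪≫ MonomialExt.homologyIso K 5
  rw [(e.toLinearEquiv.trans (MonomialExt.homEquiv K 5)).finrank_eq,
    Module.finrank_fintype_fun_eq_card,
    MonomialExt.card_chain_five]
end

section
/- Let A be the monomial algebra on 13 generators defined below and K the trivial A-module. Then dim_K Extᴬ⁶(K,K) = 1. -/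
/-!
Let `K` be a field and `V` a 13-dimensional `K`-vector space with basis
`{m,n,p,q,r,s,t,u,v,w,x,y,z}`.  Let `A = T(V)/I` be the quotient of the free
(tensor) algebra on `V` by the two-sided ideal generated by the nine monomials
`mn²p, n²pqr, npqrs, pqrst, stu, tuvwx, uvwxy, vwxy², xy²z`, and regard `K` as
the trivial left `A`-module via the augmentation sending every generator to `0`.
-/

open CategoryTheory

variable (K : Type) [Field K]

open Gen

section Words

instance : DecidableEq Gen := fun a b =>
  decidable_of_iff (a.ctorIdx = b.ctorIdx)
    ⟨fun h => by cases a <;> cases b <;> first | rfl | simp [Gen.ctorIdx] at h,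
      fun h => congrArg _ h⟩

/-- The nine defining monomials of `A`, as words. -/
def relWords : List (List Gen) :=
  [[m, n, n, p], [n, n, p, q, r], [n, p, q, r, s], [p, q, r, s, t], [s, t, u],
    [t, u, v, w, x], [u, v, w, x, y], [v, w, x, y, y], [x, y, y, z]]

/-- A word is normal if none of the defining monomials is a factor of it. -/
def IsNormal (a : List Gen) : Prop := ∀ b ∈ relWords, ¬ b <:+: a

instance : DecidablePred IsNormal := fun _ => inferInstanceAs (Decidable (∀ _ ∈ _, _))

theorem IsNormal.infix {a b : List Gen} (h : IsNormal b) (hab : a <:+: b) : IsNormal a :=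
  fun c hc hca => h c hc (hca.trans hab)

theorem isNormal_nil : IsNormal [] := by decide

/-- The word `a` annihilates the last syzygy generator of the chain `c`: the product of `a` with
the leading word of `c` is not normal. For the empty chain this means `a` is nonempty. -/
def Kills : List (List Gen) → List Gen → Prop
  | [], a => a ≠ []
  | b :: _, a => ¬ IsNormal (a ++ b)

instance : ∀ c a, Decidable (Kills c a)
  | [], a => inferInstanceAs (Decidable (a ≠ []))
  | b :: _, a => inferInstanceAs (Decidable (¬ IsNormal (a ++ b)))

theorem Kills.append_left {c : List (List Gen)} {a : List Gen} (h : Kills c a) (b : List Gen) :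
    Kills c (b ++ a) := by
  cases c with
  | nil => simp_all [Kills]
  | cons d c =>
    exact fun hn => h (hn.infix (by rw [List.append_assoc]; exact (List.suffix_append b _).isInfix))

/-- `a` extends the chain `c`: it is a normal word killing `c` and no proper suffix of it
does so. -/
def Extends (c : List (List Gen)) (a : List Gen) : Prop :=
  IsNormal a ∧ Kills c a ∧ ∀ b ∈ a.tails, Kills c b → b = a

instance (c : List (List Gen)) (a : List Gen) : Decidable (Extends c a) :=
  inferInstanceAs (Decidable (_ ∧ _ ∧ _))

/-- Anick chains, listed from their last (leftmost) word to their first letter. -/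
def IsAnickChain : List (List Gen) → Prop
  | [] => True
  | a :: c => Extends c a ∧ IsAnickChain c

theorem exists_extends {c : List (List Gen)} {a : List Gen} (ha : IsNormal a) (hc : Kills c a) :
    ∃ a' b, a = a' ++ b ∧ Extends c b := by
  induction a with
  | nil => exact ⟨[], [], rfl, ha, hc, by simp⟩
  | cons i a ih =>
    by_cases h : Kills c a
    · obtain ⟨a', b, rfl, hb⟩ := ih (ha.infix (List.suffix_cons i a).isInfix) h
      exact ⟨i :: a', b, rfl, hb⟩
    · refine ⟨[], i :: a, rfl, ha, hc, fun b hb hk => ?_⟩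
      rw [List.mem_tails, List.suffix_cons_iff] at hb
      rcases hb with hb | ⟨d, rfl⟩
      · exact hb
      · exact absurd (hk.append_left d) h

theorem Extends.unique {c : List (List Gen)} {a₁ a₂ b₁ b₂ : List Gen} (h₁ : Extends c b₁)
    (h₂ : Extends c b₂) (h : a₁ ++ b₁ = a₂ ++ b₂) : a₁ = a₂ ∧ b₁ = b₂ := by
  have hb : b₁ = b₂ := by
    rcases List.suffix_or_suffix_of_suffix (List.suffix_append a₁ b₁)
      (h ▸ List.suffix_append a₂ b₂) with hs | hs
    · exact h₂.2.2 _ ((List.mem_tails _ _).2 hs) h₁.2.1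
    · exact (h₁.2.2 _ ((List.mem_tails _ _).2 hs) h₂.2.1).symm
  subst hb
  exact ⟨List.append_cancel_right h, rfl⟩

theorem Extends.ne_nil : ∀ {c : List (List Gen)} {a : List Gen}, IsAnickChain c →
    Extends c a → a ≠ []
  | [], _, _, h => h.2.1
  | _ :: _, _, hc, h => by
    rintro rfl
    exact h.2.1 hc.1.1

/-- Anick chains of length `k`, indexing the generators of the `k`-th module of the
resolution. -/
def Chain (k : ℕ) : Type := {c : List (List Gen) // IsAnickChain c ∧ c.length = k}

namespace Chain

/-- The leftmost word of a chain. -/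
def head {k : ℕ} (c : Chain (k + 1)) : List Gen := c.1.headI

/-- The chain without its leftmost word. -/
def tail {k : ℕ} (c : Chain (k + 1)) : Chain k :=
  ⟨c.1.tail, by
    obtain ⟨_ | ⟨a, c⟩, h, hl⟩ := c
    · simp at hl
    · exact ⟨h.2, by simpa using hl⟩⟩

/-- The chain obtained by adding a leftmost word. -/
def cons {k : ℕ} (c : Chain k) (a : List Gen) (h : Extends c.1 a) : Chain (k + 1) :=
  ⟨a :: c.1, ⟨h, c.2.1⟩, by simp [c.2.2]⟩

theorem val_eq {k : ℕ} (c : Chain (k + 1)) : c.1 = c.head :: c.tail.1 := by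
  obtain ⟨_ | ⟨a, c⟩, h, hl⟩ := c
  · simp at hl
  · rfl

theorem extends_head {k : ℕ} (c : Chain (k + 1)) : Extends c.tail.1 c.head := by
  have h := c.2.1
  rw [c.val_eq] at h
  exact h.1

theorem head_ne_nil {k : ℕ} (c : Chain (k + 1)) : c.head ≠ [] :=
  c.extends_head.ne_nil c.tail.2.1

theorem eq_of_append_head_eq {k : ℕ} {c₁ c₂ : Chain (k + 1)} {a₁ a₂ : List Gen}
    (ht : c₁.tail = c₂.tail) (h : a₁ ++ c₁.head = a₂ ++ c₂.head) : a₁ = a₂ ∧ c₁ = c₂ := by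
  obtain ⟨h₁, h₂⟩ := c₁.extends_head.unique (ht ▸ c₂.extends_head) h
  exact ⟨h₁, Subtype.ext (by rw [val_eq, val_eq, ht, h₂])⟩

instance : Unique (Chain 0) where
  default := ⟨[], trivial, rfl⟩
  uniq c := Subtype.ext (List.length_eq_zero_iff.1 c.2.2)

end Chain

/-- The candidates for a word extending a chain with leading word `a`: the initial segments `b` of
the defining monomials whose complementary final segment is an initial segment of `a`. -/
def extensionCandidates (a : List Gen) : List (List Gen) :=
  relWords.flatMap fun d => d.inits.filter fun b => d.drop b.length <+: a

theorem mem_extensionCandidates {a b : List Gen} {c : List (List Gen)}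
    (hb : Extends (a :: c) b) (ha : IsNormal a) : b ∈ extensionCandidates a := by
  obtain ⟨hn, hk, hmin⟩ := hb
  simp only [Kills, IsNormal, not_forall, not_not] at hk
  obtain ⟨d, hd, l₁, l₂, h⟩ := hk
  have hl₁ : l₁ = [] := by
    rcases l₁ with _ | ⟨i, l₁⟩
    · rfl
    rcases b with _ | ⟨j, b⟩
    · exact absurd ⟨i :: l₁, l₂, h⟩ (ha d hd)
    · have := hmin b (by simp) (fun hN => hN d hd ⟨l₁, l₂, by simpa using (List.cons.inj h).2⟩)
      simp at this
  subst hl₁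
  rw [List.nil_append] at h
  have hbd : b <+: d := by
    rcases List.prefix_or_prefix_of_prefix (List.prefix_append b a) (h ▸ List.prefix_append d l₂)
      with hs | hs
    · exact hs
    · exact absurd hs.isInfix (hn d hd)
  obtain ⟨e, rfl⟩ := hbd
  simp only [extensionCandidates, List.mem_flatMap, List.mem_filter, List.mem_inits]
  refine ⟨_, hd, List.prefix_append _ _, ?_⟩
  rw [List.append_assoc] at h
  simpa using ⟨l₂, List.append_cancel_left h⟩

/-- A list containing all Anick chains of length `k + 1`. -/
def chainList : ℕ → List (List (List Gen))
  | 0 => [m, n, p, q, r, s, t, u, v, w, x, y, z].map fun i => [[i]]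
  | k + 1 => (chainList k).flatMap fun c =>
      ((extensionCandidates c.headI).filter fun a => Extends c a).map fun a => a :: c

theorem mem_chainList : ∀ {k : ℕ} {c : List (List Gen)}, IsAnickChain c → c.length = k + 1 →
    c ∈ chainList k
  | 0, [a], hc, _ => by
    obtain _ | ⟨i, a⟩ := a
    · exact absurd rfl hc.1.2.1
    · obtain rfl : a = [] := by
        by_contra h
        simpa using hc.1.2.2 a (by simp) h
      cases i <;> decide
  | k + 1, a :: b :: c, hc, hl => by
    simp only [chainList, List.mem_flatMap, List.mem_map, List.mem_filter, decide_eq_true_eq]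
    exact ⟨b :: c, mem_chainList hc.2 (by simpa using hl), a,
      ⟨mem_extensionCandidates hc.1 hc.2.1.1, hc.1⟩, rfl⟩

/-- The only Anick chain of length six. -/
def chainSix : Chain 6 :=
  ⟨[[n, n], [p, q, r], [s, t], [u], [v, w, x, y], [y]], by
    simp only [IsAnickChain]; decide +kernel, rfl⟩

theorem Chain.eq_chainSix (c : Chain 6) : c = chainSix := by
  have h : ∀ c ∈ chainList 5, c = chainSix.1 := by decide +kernel
  exact Subtype.ext (h c.1 (mem_chainList c.2.1 c.2.2))

end Words

section Algebra

/-- The image in `A` of a word. -/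
noncomputable def mon (a : List Gen) : A K :=
  (a.map fun i => RingQuot.mkAlgHom K (MonRel K) (g K i)).prod

@[simp]
theorem mon_nil : mon K [] = 1 := rfl

theorem mon_append (a b : List Gen) : mon K (a ++ b) = mon K a * mon K b := by
  simp [mon]

theorem mon_eq_zero {a : List Gen} (ha : ¬ IsNormal a) : mon K a = 0 := by
  simp only [IsNormal, not_forall, not_not] at ha
  obtain ⟨b, hb, c, d, rfl⟩ := ha
  suffices h : mon K b = 0 by simp [mon_append, h]
  have key : ∀ {f : FreeAlgebra K Gen}, MonRel K f 0 → RingQuot.mkAlgHom K (MonRel K) f = 0 :=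
    fun h => by simpa using RingQuot.mkAlgHom_rel K h
  simp only [relWords, List.mem_cons, List.not_mem_nil, or_false] at hb
  rcases hb with rfl | rfl | rfl | rfl | rfl | rfl | rfl | rfl | rfl
  · simpa [mon, mul_assoc] using key .mnnp
  · simpa [mon, mul_assoc] using key .nnpqr
  · simpa [mon, mul_assoc] using key .npqrs
  · simpa [mon, mul_assoc] using key .pqrst
  · simpa [mon, mul_assoc] using key .stu
  · simpa [mon, mul_assoc] using key .tuvwx
  · simpa [mon, mul_assoc] using key .uvwxy
  · simpa [mon, mul_assoc] using key .vwxyy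
  · simpa [mon, mul_assoc] using key .xyyz

theorem aug_mon {a : List Gen} (ha : a ≠ []) : aug K (mon K a) = 0 := by
  obtain ⟨i, a, rfl⟩ := List.exists_cons_of_ne_nil ha
  simp [mon, aug, g]

/-- Left multiplication by the letter `i` on the space spanned by all words, with the words that
are not normal set to zero. -/
noncomputable def letterMul (i : Gen) : Module.End K (List Gen →₀ K) :=
  Finsupp.linearCombination K fun a =>
    if IsNormal (i :: a) then Finsupp.single (i :: a) 1 else 0

theorem letterMul_single (i : Gen) (a : List Gen) :
    letterMul K i (Finsupp.single a 1) =
      if IsNormal (i :: a) then Finsupp.single (i :: a) 1 else 0 := by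
  simp [letterMul]

theorem prod_letterMul_single (i : Gen) (a b : List Gen) :
    ((i :: a).map (letterMul K)).prod (Finsupp.single b 1) =
      if IsNormal (i :: a ++ b) then Finsupp.single (i :: a ++ b) 1 else 0 := by
  induction a generalizing i with
  | nil => simp [letterMul_single]
  | cons j a ih =>
    rw [List.map_cons, List.prod_cons, Module.End.mul_apply, ih]
    split_ifs with h₁ h₂ h₂
    · rw [letterMul_single, ← List.cons_append, if_pos h₂, List.cons_append]
    · rw [letterMul_single, ← List.cons_append, if_neg h₂]
    · exact absurd (h₂.infix (List.suffix_cons i _).isInfix) h₁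
    · simp

theorem prod_letterMul_eq_zero {a : List Gen} (ha : ¬ IsNormal a) :
    (a.map (letterMul K)).prod = 0 := by
  cases a with
  | nil => exact absurd isNormal_nil ha
  | cons i a =>
    refine Finsupp.lhom_ext' fun b => LinearMap.ext_ring ?_
    have h : ¬ IsNormal (i :: a ++ b) :=
      fun h => ha (h.infix (List.prefix_append (i :: a) b).isInfix)
    exact (prod_letterMul_single K i a b).trans (if_neg h)

/-- The action of `A` on the space spanned by all words. -/
noncomputable def wordRep : A K →ₐ[K] Module.End K (List Gen →₀ K) :=
  RingQuot.liftAlgHom K ⟨FreeAlgebra.lift K (letterMul K), by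
    have key : ∀ b ∈ relWords, (b.map (letterMul K)).prod = 0 := fun b hb =>
      prod_letterMul_eq_zero K fun h => h b hb List.infix_rfl
    simp only [relWords, List.forall_mem_cons, List.map_cons, List.map_nil, List.prod_cons,
      List.prod_nil, mul_one] at key
    intro f f' h
    induction h <;> simp [g, mul_assoc, key]⟩

theorem wordRep_mon (a : List Gen) : wordRep K (mon K a) = (a.map (letterMul K)).prod := by
  simp [wordRep, mon, g, map_list_prod, Function.comp_def]

theorem wordRep_mon_single_nil {a : List Gen} (ha : IsNormal a) :
    wordRep K (mon K a) (Finsupp.single [] 1) = Finsupp.single a 1 := by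
  rw [wordRep_mon]
  cases a with
  | nil => rfl
  | cons i a => simpa [ha] using prod_letterMul_single K i a []

theorem linearIndependent_mon :
    LinearIndependent K fun a : {a // IsNormal a} => mon K a.1 := by
  refine LinearIndependent.of_comp
    ((LinearMap.applyₗ (Finsupp.single [] 1)).comp (wordRep K).toLinearMap) ?_
  have h : (fun a : {a // IsNormal a} => Finsupp.single a.1 (1 : K)) =
      ((LinearMap.applyₗ (Finsupp.single [] 1)).comp (wordRep K).toLinearMap) ∘
        fun a : {a // IsNormal a} => mon K a.1 :=
    funext fun a => (wordRep_mon_single_nil K a.2).symm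
  rw [← h]
  exact (Finsupp.basisSingleOne (R := K)).linearIndependent.comp _ Subtype.val_injective

theorem span_mon :
    ⊤ ≤ Submodule.span K (Set.range fun a : {a // IsNormal a} => mon K a.1) := by
  have hmem : ∀ a, mon K a ∈ Submodule.span K
      (Set.range fun a : {a // IsNormal a} => mon K a.1) := fun a => by
    by_cases ha : IsNormal a
    · exact Submodule.subset_span ⟨⟨a, ha⟩, rfl⟩
    · simp [mon_eq_zero K ha]
  rintro b -
  obtain ⟨f, rfl⟩ := RingQuot.mkAlgHom_surjective K (MonRel K) b
  suffices h : ∀ a, RingQuot.mkAlgHom K (MonRel K) f * mon K a ∈ Submodule.span K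
      (Set.range fun a : {a // IsNormal a} => mon K a.1) by simpa using h []
  induction f using FreeAlgebra.induction with
  | grade0 k =>
    intro a
    rw [AlgHom.commutes, ← Algebra.smul_def]
    exact Submodule.smul_mem _ _ (hmem a)
  | grade1 i => exact fun a => by simpa [mon, g] using hmem (i :: a)
  | add f₁ f₂ h₁ h₂ =>
    intro a
    rw [map_add, add_mul]
    exact add_mem (h₁ a) (h₂ a)
  | mul f₁ f₂ h₁ h₂ =>
    intro a
    rw [map_mul, mul_assoc]
    have h := h₂ a
    refine Submodule.span_induction (p := fun b _ => RingQuot.mkAlgHom K (MonRel K) f₁ * b ∈ _)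
      ?_ (by simp) (fun _ _ _ _ h h' => by rw [mul_add]; exact add_mem h h')
      (fun k _ _ h => by rw [mul_smul_comm]; exact Submodule.smul_mem _ _ h) h
    rintro _ ⟨a, rfl⟩
    exact h₁ a.1

/-- The `K`-basis of `A` formed by the normal words. -/
noncomputable def monBasis : Module.Basis {a // IsNormal a} K (A K) :=
  .mk (linearIndependent_mon K) (span_mon K)

@[simp]
theorem monBasis_apply (a : {a // IsNormal a}) : monBasis K a = mon K a.1 :=
  Module.Basis.mk_apply _ _ a

end Algebra

section Resolution

/-- The free `A`-module on the chains of length `k`. -/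
abbrev ChainModule (k : ℕ) : Type := Chain k →₀ A K

/-- The `K`-basis of the `k`-th module of the resolution, consisting of the normal multiples of the
chains of length `k`. -/
noncomputable def chainBasis (k : ℕ) :
    Module.Basis (Σ _ : Chain k, {a // IsNormal a}) K (ChainModule K k) :=
  Finsupp.basis fun _ => monBasis K

@[simp]
theorem chainBasis_apply {k : ℕ} (c : Chain k) (a : {a // IsNormal a}) :
    chainBasis K k ⟨c, a⟩ = Finsupp.single c (mon K a.1) := by
  simp [chainBasis, Finsupp.coe_basis]

/-- The differential of the Anick resolution. -/
noncomputable def anickDiff (k : ℕ) : ChainModule K (k + 1) →ₗ[A K] ChainModule K k :=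
  Finsupp.linearCombination (A K) fun c => Finsupp.single c.tail (mon K c.head)

@[simp]
theorem anickDiff_single {k : ℕ} (c : Chain (k + 1)) (a : A K) :
    anickDiff K k (Finsupp.single c a) = Finsupp.single c.tail (a * mon K c.head) := by
  simp [anickDiff]

theorem anickDiff_single_mon {k : ℕ} (c : Chain (k + 1)) (a : List Gen) :
    anickDiff K k (Finsupp.single c (mon K a)) = Finsupp.single c.tail (mon K (a ++ c.head)) := by
  rw [anickDiff_single, mon_append]

theorem anickDiff_comp (k : ℕ) : anickDiff K k ∘ₗ anickDiff K (k + 1) = 0 := by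
  refine Finsupp.lhom_ext' fun c => LinearMap.ext_ring ?_
  have h := c.extends_head.2.1
  rw [c.tail.val_eq] at h
  simp [← mon_append, mon_eq_zero K h]

open Classical in
/-- The values on the words of the contracting homotopy of the Anick resolution. -/
noncomputable def homotopyFun (k : ℕ) (c : Chain k) (a : List Gen) : ChainModule K (k + 1) :=
  if h : ∃ b : List Gen × Chain (k + 1), b.2.tail = c ∧ b.1 ++ b.2.head = a then
    Finsupp.single h.choose.2 (mon K h.choose.1)
  else 0

theorem homotopyFun_append_head {k : ℕ} (c : Chain (k + 1)) (a : List Gen) :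
    homotopyFun K k c.tail (a ++ c.head) = Finsupp.single c (mon K a) := by
  have h : ∃ b : List Gen × Chain (k + 1), b.2.tail = c.tail ∧ b.1 ++ b.2.head = a ++ c.head :=
    ⟨(a, c), rfl, rfl⟩
  obtain ⟨h₁, h₂⟩ := Chain.eq_of_append_head_eq h.choose_spec.1 h.choose_spec.2
  rw [homotopyFun, dif_pos h, h₁, h₂]

/-- The `K`-linear contracting homotopy of the Anick resolution. -/
noncomputable def homotopy (k : ℕ) : ChainModule K k →ₗ[K] ChainModule K (k + 1) :=
  (chainBasis K k).constr K fun b => homotopyFun K k b.1 b.2.1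

theorem homotopy_single {k : ℕ} (c : Chain k) {a : List Gen} (ha : IsNormal a) :
    homotopy K k (Finsupp.single c (mon K a)) = homotopyFun K k c a := by
  rw [← chainBasis_apply K c ⟨a, ha⟩, homotopy, Module.Basis.constr_basis]

theorem anickDiff_homotopy_of_kills {k : ℕ} (c : Chain k) {a : List Gen} (ha : IsNormal a)
    (h : Kills c.1 a) : anickDiff K k (homotopy K k (Finsupp.single c (mon K a))) =
      Finsupp.single c (mon K a) := by
  obtain ⟨a', b, rfl, hb⟩ := exists_extends ha h
  rw [homotopy_single K c ha]
  exact (congrArg (anickDiff K k) (homotopyFun_append_head K (c.cons b hb) a')).trans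
    (anickDiff_single_mon K (c.cons b hb) a')

theorem homotopy_of_not_kills {k : ℕ} (c : Chain k) {a : List Gen} (ha : IsNormal a)
    (h : ¬ Kills c.1 a) : homotopy K k (Finsupp.single c (mon K a)) = 0 := by
  rw [homotopy_single K c ha, homotopyFun, dif_neg]
  rintro ⟨⟨b, c'⟩, rfl, rfl⟩
  exact h (c'.extends_head.2.1.append_left b)

theorem homotopy_anickDiff_add_anickDiff_homotopy (k : ℕ) :
    homotopy K k ∘ₗ (anickDiff K k).restrictScalars K +
      (anickDiff K (k + 1)).restrictScalars K ∘ₗ homotopy K (k + 1) = LinearMap.id := by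
  refine (chainBasis K (k + 1)).ext ?_
  rintro ⟨c, a, ha⟩
  simp only [chainBasis_apply, LinearMap.add_apply, LinearMap.id_apply, LinearMap.comp_apply,
    LinearMap.restrictScalars_apply, anickDiff_single_mon]
  have hk : Kills c.1 a ↔ ¬ IsNormal (a ++ c.head) := by rw [c.val_eq]; rfl
  by_cases h : IsNormal (a ++ c.head)
  · rw [homotopy_of_not_kills K c ha (by simpa [hk] using h), homotopy_single K _ h,
      homotopyFun_append_head, map_zero, add_zero]
  · rw [mon_eq_zero K h, Finsupp.single_zero, map_zero, zero_add,
      anickDiff_homotopy_of_kills K c ha (hk.2 h)]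

theorem anickDiff_exact (k : ℕ) : Function.Exact (anickDiff K (k + 1)) (anickDiff K k) := by
  refine fun f => ⟨fun h => ⟨homotopy K (k + 1) f, ?_⟩, ?_⟩
  · simpa [h] using LinearMap.congr_fun (homotopy_anickDiff_add_anickDiff_homotopy K k) f
  · rintro ⟨f, rfl⟩
    exact LinearMap.congr_fun (anickDiff_comp K k) f

theorem Chain.kills_iff (c : Chain 0) {a : List Gen} : Kills c.1 a ↔ a ≠ [] := by
  obtain ⟨c, _, hc⟩ := c
  obtain rfl := List.length_eq_zero_iff.1 hc
  rfl

theorem algebraMap_aug_add_anickDiff_homotopy :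
    (Finsupp.lsingle (default : Chain 0) ∘ₗ Algebra.linearMap K (A K)) ∘ₗ (aug K).toLinearMap ∘ₗ
      Finsupp.lapply default + (anickDiff K 0).restrictScalars K ∘ₗ homotopy K 0 =
      LinearMap.id := by
  refine (chainBasis K 0).ext ?_
  rintro ⟨c, a, ha⟩
  obtain rfl := Subsingleton.elim c default
  by_cases h : a = []
  · subst h
    have := homotopy_of_not_kills K default ha (mt (Chain.kills_iff _).1 (not_not.2 rfl))
    rw [mon_nil] at this
    simp [this]
  · simpa [aug_mon K h] using anickDiff_homotopy_of_kills K default ha ((Chain.kills_iff _).2 h)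

theorem mem_range_anickDiff_zero {f : ChainModule K 0} (h : aug K (f default) = 0) :
    ∃ f', anickDiff K 0 f' = f :=
  ⟨homotopy K 0 f, by
    simpa [h] using LinearMap.congr_fun (algebraMap_aug_add_anickDiff_homotopy K) f⟩

end Resolution

section Ext

/-- The identification of `K` with the underlying group of the trivial module. -/
noncomputable def toKMod : K ≃+ KMod K := AddEquiv.refl K

theorem smul_toKMod (a : A K) (k : K) : a • toKMod K k = toKMod K (aug K a * k) := rfl

theorem smul_KMod_eq_zero {a : A K} (h : aug K a = 0) (k : KMod K) : a • k = 0 := by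
  obtain ⟨k, rfl⟩ := (toKMod K).surjective k
  rw [smul_toKMod, h, zero_mul, map_zero]

/-- The augmentation of the Anick resolution. -/
noncomputable def anickAug : ChainModule K 0 →ₗ[A K] KMod K :=
  Finsupp.linearCombination (A K) fun _ => toKMod K 1

theorem anickAug_apply (f : ChainModule K 0) :
    anickAug K f = toKMod K (aug K (f default)) := by
  rw [Finsupp.unique_single f, anickAug, Finsupp.linearCombination_single, smul_toKMod, mul_one,
    Finsupp.single_eq_same]

theorem map_comp_anickDiff (k : ℕ) (f : ChainModule K k →ₗ[A K] KMod K) :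
    f ∘ₗ anickDiff K k = 0 := by
  refine Finsupp.lhom_ext' fun c => LinearMap.ext_ring ?_
  have h : Finsupp.single c.tail (mon K c.head) =
      mon K c.head • Finsupp.single c.tail (1 : A K) := by simp
  simp only [LinearMap.comp_apply, Finsupp.lsingle_apply, anickDiff_single, one_mul,
    LinearMap.zero_apply]
  rw [h, map_smul]
  exact smul_KMod_eq_zero K (aug_mon K c.head_ne_nil) _

theorem anickAug_exact : Function.Exact (anickDiff K 0) (anickAug K) := by
  refine fun f => ⟨fun h => mem_range_anickDiff_zero K ?_, ?_⟩
  · simpa [anickAug_apply] using h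
  · rintro ⟨f, rfl⟩
    exact LinearMap.congr_fun (map_comp_anickDiff K 0 (anickAug K)) f

theorem anickAug_surjective : Function.Surjective (anickAug K) := by
  intro k
  obtain ⟨k, rfl⟩ := (toKMod K).surjective k
  refine ⟨Finsupp.single default (algebraMap K (A K) k), ?_⟩
  rw [anickAug_apply, Finsupp.single_eq_same, AlgHom.commutes]
  rfl

/-- The Anick resolution, as a complex of left `A`-modules. -/
noncomputable def anickComplex : ChainComplex (ModuleCat.{0} (A K)) ℕ :=
  ChainComplex.of (fun k => ModuleCat.of (A K) (ChainModule K k))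
    (fun k => ModuleCat.ofHom (anickDiff K k))
    fun k => by rw [← ModuleCat.ofHom_comp, anickDiff_comp]; rfl

theorem anickComplex_d (k : ℕ) :
    (anickComplex K).d (k + 1) k = ModuleCat.ofHom (anickDiff K k) :=
  ChainComplex.of_d (fun k => ModuleCat.of (A K) (ChainModule K k))
    (fun k => ModuleCat.ofHom (anickDiff K k)) k

theorem anickComplex_exactAt_succ (k : ℕ) : (anickComplex K).ExactAt (k + 1) := by
  rw [HomologicalComplex.exactAt_iff' _ (k + 2) (k + 1) k (by simp) (by simp),
    ShortComplex.moduleCat_exact_iff]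
  intro f hf
  obtain ⟨f', h⟩ := (anickDiff_exact K k f).1
    ((congrArg (fun d => d.hom f) (anickComplex_d K k)).symm.trans hf)
  exact ⟨f', (congrArg (fun d => d.hom f') (anickComplex_d K (k + 1))).trans h⟩

/-- The augmentation of the Anick resolution, as a morphism of modules. -/
noncomputable def anickAugHom : (anickComplex K).X 0 ⟶ KMod K :=
  ModuleCat.ofHom (X := ChainModule K 0) (Y := KMod K) (anickAug K)

theorem anickComplex_d_comp_anickAugHom : (anickComplex K).d 1 0 ≫ anickAugHom K = 0 := by
  rw [anickComplex_d K 0]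
  exact ModuleCat.hom_ext (map_comp_anickDiff K 0 (anickAug K))

/-- The Anick resolution of the trivial module. -/
noncomputable def anickResolution : ProjectiveResolution (KMod K) where
  complex := anickComplex K
  projective k := ModuleCat.projective_of_free (M := ModuleCat.of (A K) (ChainModule K k))
    Finsupp.basisSingleOne
  π := (ChainComplex.toSingle₀Equiv _ _).symm
    ⟨anickAugHom K, anickComplex_d_comp_anickAugHom K⟩
  quasiIso := ⟨fun k => by
    induction k with
    | zero =>
      rw [ChainComplex.quasiIsoAt₀_iff, ShortComplex.quasiIso_iff_of_zeros' _ rfl rfl rfl]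
      constructor
      · rw [ShortComplex.moduleCat_exact_iff]
        intro f hf
        obtain ⟨f', h⟩ := (anickAug_exact K f).1 hf
        exact ⟨f', (congrArg (fun d => d.hom f') (anickComplex_d K 0)).trans h⟩
      · rw [ModuleCat.epi_iff_surjective]
        exact anickAug_surjective K
    | succ k _ =>
      rw [quasiIsoAt_iff_exactAt' (hL := ChainComplex.exactAt_succ_single_obj ..)]
      exact anickComplex_exactAt_succ K k⟩

theorem linearYonedaObj_d (i j : ℕ) :
    ((anickComplex K).linearYonedaObj K (KMod K)).d i j = 0 := by
  by_cases h : i + 1 = j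
  · subst h
    refine ModuleCat.hom_ext (LinearMap.ext fun f => ModuleCat.hom_ext ?_)
    have := map_comp_anickDiff K i (ModuleCat.Hom.hom f)
    rw [ChainComplex.linearYonedaObj_d, anickComplex_d]
    exact this
  · exact HomologicalComplex.shape _ _ _ h

/-- `Ext` of the trivial module is computed by the dual of the minimal resolution. -/
noncomputable def extIso (k : ℕ) :
    extKK K k ≅ ((anickComplex K).linearYonedaObj K (KMod K)).X k :=
  (anickResolution K).isoExt k (KMod K) ≪≫
    (HomologicalComplex.isoHomologyπ _ _ k rfl (linearYonedaObj_d K _ k)).symm ≪≫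
    HomologicalComplex.iCyclesIso _ k _ rfl (linearYonedaObj_d K k _)

theorem smul_hom_apply {k : ℕ} (a : K) (f : (anickComplex K).X k ⟶ KMod K)
    (x : ChainModule K k) :
    (a • f).hom x = algebraMap K (A K) a • f.hom x := rfl

end Ext

/-- `dim_K Extᴬ⁶(K,K) = 1`. -/
theorem statement_7 : Module.finrank K (extKK K 6) = 1 := by
  rw [(extIso K 6).toLinearEquiv.finrank_eq]
  let f : (anickComplex K).X 6 ⟶ KMod K := ModuleCat.ofHom (X := ChainModule K 6) (Y := KMod K)
    (Finsupp.linearCombination (A K) fun _ => toKMod K 1)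
  have hf : f.hom (Finsupp.single chainSix (1 : A K)) = toKMod K 1 :=
    (Finsupp.linearCombination_single _ _ _).trans (one_smul _ _)
  refine finrank_eq_one (R := K) (M := ((anickComplex K).X 6 ⟶ KMod K)) f ?_ fun h => ?_
  · intro h
    rw [h] at hf
    exact one_ne_zero ((toKMod K).injective (hf.symm.trans (map_zero (toKMod K)).symm))
  · obtain ⟨b, hb⟩ := (toKMod K).surjective (h.hom (Finsupp.single chainSix (1 : A K)))
    refine ⟨b, ModuleCat.hom_ext (Finsupp.lhom_ext' fun c => LinearMap.ext_ring ?_)⟩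
    obtain rfl := c.eq_chainSix
    refine (smul_hom_apply K b f _).trans ?_
    refine (congrArg (algebraMap K (A K) b • ·) hf).trans ?_
    refine .trans ?_ hb
    simp only [smul_toKMod, AlgHom.commutes, mul_one]
    rfl
end
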